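/- A graph G is a mixed unit interval graph if and only if G is an interval graph containing no induced subgraph isomorphic to G_1 nor to any graph in the families R_i (i ≥ 0), S_i (i ≥ 1), S''_i (i ≥ 2), or T_{i,j} (i ≥ j ≥ 0), where G_1 is K_{2,3}^* together with one extra vertex adjacent to one vertex of the 2-side and one vertex of the 3-side. -/

import Mathlib

open Set

/-- A unit interval of the real line: one of the four types of intervals of length 1. -/
def IsUnitInterval (s : Set ℝ) : Prop :=
  ∃ x : ℝ, s = Set.Icc x (x + 1) ∨ s = Set.Ioo x (x + 1) ∨
    s = Set.Ioc x (x + 1) ∨ s = Set.Ico x (x + 1)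

/-- `f` is an intersection representation of `G`: distinct vertices are adjacent iff
their assigned sets intersect. -/
def IsIntervalRep {V : Type*} (G : SimpleGraph V) (f : V → Set ℝ) : Prop :=
  ∀ u v : V, u ≠ v → (G.Adj u v ↔ (f u ∩ f v).Nonempty)

/-- A mixed unit interval graph: intersection graph of unit intervals of any of the four types. -/
def MixedUnitIntervalGraph {V : Type*} (G : SimpleGraph V) : Prop :=
  ∃ f : V → Set ℝ, IsIntervalRep G f ∧ ∀ v, IsUnitInterval (f v)

/-- `G` contains an induced subgraph isomorphic to `H`. -/
def HasInducedSubgraph {V W : Type*} (G : SimpleGraph V) (H : SimpleGraph W) : Prop :=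
  ∃ f : W ↪ V, ∀ a b : W, H.Adj a b ↔ G.Adj (f a) (f b)

/-- `G` is an interval graph (intersection graph of closed real intervals). -/
def IsIntervalGraph {V : Type*} (G : SimpleGraph V) : Prop :=
  ∃ f : V → Set ℝ, IsIntervalRep G f ∧ ∀ v, ∃ a b : ℝ, f v = Set.Icc a b

/-- `G` is twin-free: distinct vertices have distinct closed neighborhoods. -/
def TwinFree {V : Type*} (G : SimpleGraph V) : Prop :=
  ∀ u v : V, insert u (G.neighborSet u) = insert v (G.neighborSet v) → u = v

/-! ### The forbidden families R_k, S_k, S'_k, S''_k, T_{i,j}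

`Qgraph k` is the graph Q_k (R_k minus two degree-1 vertices with a common neighbor):
a path p_1 ... p_{k+1} (indices 0..k), triangle vertices t_1 ... t_k (index i-1
for t_i, adjacent to p_i and p_{i+1}), and two pendant vertices attached at p_1.
Its special vertices are p_{k+1} and t_k. -/

abbrev QVert (k : ℕ) := Fin (k + 1) ⊕ (Fin k ⊕ Fin 2)

def Qadj (k : ℕ) : QVert k → QVert k → Prop
  | Sum.inl m, Sum.inl m' => (m' : ℕ) = (m : ℕ) + 1
  | Sum.inr (Sum.inl i), Sum.inl m => (m : ℕ) = (i : ℕ) ∨ (m : ℕ) = (i : ℕ) + 1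
  | Sum.inr (Sum.inr _), Sum.inl m => (m : ℕ) = 0
  | _, _ => False

def Qgraph (k : ℕ) : SimpleGraph (QVert k) := SimpleGraph.fromRel (Qadj k)

/-- The first special vertex of Q_k : the path endpoint p_{k+1}. -/
def Qspecial1 (k : ℕ) : QVert k := Sum.inl (Fin.last k)

/-- The second special vertex of Q_k : the triangle vertex t_k
(for k = 0 a pendant vertex). -/
def Qspecial2 (k : ℕ) : QVert k :=
  if h : k = 0 then Sum.inr (Sum.inr 1) else Sum.inr (Sum.inl ⟨k - 1, by omega⟩)

/-- R_k : a path p_0 ... p_{k+2}, triangle vertices t_1 ... t_k (index i-1 for t_i,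
adjacent to p_i and p_{i+1}) and two further leaves adjacent to p_1 and p_{k+1}. -/
def Radj (k : ℕ) : (Fin (k + 3) ⊕ (Fin k ⊕ Fin 2)) → (Fin (k + 3) ⊕ (Fin k ⊕ Fin 2)) → Prop
  | Sum.inl m, Sum.inl m' => (m' : ℕ) = (m : ℕ) + 1
  | Sum.inr (Sum.inl i), Sum.inl m => (m : ℕ) = (i : ℕ) + 1 ∨ (m : ℕ) = (i : ℕ) + 2
  | Sum.inr (Sum.inr j), Sum.inl m =>
      ((j : ℕ) = 0 ∧ (m : ℕ) = 1) ∨ ((j : ℕ) = 1 ∧ (m : ℕ) = k + 1)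
  | _, _ => False

def Rgraph (k : ℕ) : SimpleGraph (Fin (k + 3) ⊕ (Fin k ⊕ Fin 2)) :=
  SimpleGraph.fromRel (Radj k)

/-- The third neighbor of the extra vertex z in S_k : the triangle vertex t_{k-1}
if k ≥ 2, and a pendant vertex of Q_1 if k = 1. -/
def Sextra (k : ℕ) : QVert k :=
  if h : k ≤ 1 then Sum.inr (Sum.inr 0) else Sum.inr (Sum.inl ⟨k - 2, by omega⟩)

/-- S_k (k ≥ 1): Q_k together with an extra vertex z adjacent to t_k, p_k and
(t_{k-1} if k ≥ 2, a pendant of Q_1 if k = 1). -/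
def Sadj (k : ℕ) : (QVert k ⊕ Unit) → (QVert k ⊕ Unit) → Prop
  | Sum.inl a, Sum.inl b => Qadj k a b
  | Sum.inr _, Sum.inl b =>
      b = Qspecial2 k ∨ b = Sum.inl ⟨k - 1, by omega⟩ ∨ b = Sextra k
  | _, _ => False

def Sgraph (k : ℕ) : SimpleGraph (QVert k ⊕ Unit) := SimpleGraph.fromRel (Sadj k)

/-- S'_k (k ≥ 1): Q_k together with an extra vertex z adjacent to the two special
vertices p_{k+1} and t_k of Q_k and to their common neighbor p_k. -/
def S'adj (k : ℕ) : (QVert k ⊕ Unit) → (QVert k ⊕ Unit) → Prop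
  | Sum.inl a, Sum.inl b => Qadj k a b
  | Sum.inr _, Sum.inl b =>
      b = Qspecial1 k ∨ b = Qspecial2 k ∨ b = Sum.inl ⟨k - 1, by omega⟩
  | _, _ => False

def S'graph (k : ℕ) : SimpleGraph (QVert k ⊕ Unit) := SimpleGraph.fromRel (S'adj k)

/-- S''_k (k ≥ 2): S_k together with the extra edge between z and p_{k-1}. -/
def S''adj (k : ℕ) : (QVert k ⊕ Unit) → (QVert k ⊕ Unit) → Prop
  | Sum.inl a, Sum.inl b => Qadj k a b
  | Sum.inr _, Sum.inl b =>
      b = Qspecial2 k ∨ b = Sum.inl ⟨k - 1, by omega⟩ ∨ b = Sextra k ∨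
        b = Sum.inl ⟨k - 2, by omega⟩
  | _, _ => False

def S''graph (k : ℕ) : SimpleGraph (QVert k ⊕ Unit) := SimpleGraph.fromRel (S''adj k)

/-- T_{i,j}: the disjoint union of Q_i and Q_j together with the three edges
v_i v_j, v_i w_j and w_i v_j between the special vertices (v = Qspecial1, w = Qspecial2). -/
def Tadj (i j : ℕ) : (QVert i ⊕ QVert j) → (QVert i ⊕ QVert j) → Prop
  | Sum.inl a, Sum.inl b => Qadj i a b
  | Sum.inr a, Sum.inr b => Qadj j a b
  | Sum.inl a, Sum.inr b =>
      (a = Qspecial1 i ∧ b = Qspecial1 j) ∨ (a = Qspecial1 i ∧ b = Qspecial2 j) ∨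
        (a = Qspecial2 i ∧ b = Qspecial1 j)
  | _, _ => False

def Tgraph (i j : ℕ) : SimpleGraph (QVert i ⊕ QVert j) := SimpleGraph.fromRel (Tadj i j)

/-- K_{2,3}^*: K_{2,3} with parts {0,1} and {2,3,4}, with the extra edge 01. -/
def K23star : SimpleGraph (Fin 5) := SimpleGraph.fromRel (fun u v =>
  (u = 0 ∧ v = 1) ∨ ((u = 0 ∨ u = 1) ∧ (v = 2 ∨ v = 3 ∨ v = 4)))

/-- G_1: K_{2,3}^* (parts {0,1} and {2,3,4}, extra edge 01) together with an extra
vertex 5 adjacent to 0 and 2. -/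
def G1 : SimpleGraph (Fin 6) := SimpleGraph.fromRel (fun u v =>
  (u = 0 ∧ v = 1) ∨ ((u = 0 ∨ u = 1) ∧ (v = 2 ∨ v = 3 ∨ v = 4)) ∨ (u = 5 ∧ (v = 0 ∨ v = 2)))

/-! ### Forward direction -/

/-- Abstract position function extracted from a mixed unit interval representation. -/
structure PosFun {V : Type*} (G : SimpleGraph V) (x : V → ℝ) : Prop where
  near : ∀ u v, G.Adj u v → |x u - x v| ≤ 1
  far : ∀ u v, u ≠ v → ¬ G.Adj u v → 1 ≤ |x u - x v|
  rect : ∀ u u' v v', x u = x u' → x v = x v' → |x u - x v| = 1 →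
    G.Adj u v' → G.Adj u' v → G.Adj u v

theorem exists_posFun {V : Type*} {G : SimpleGraph V} (h : MixedUnitIntervalGraph G) :
    ∃ x, PosFun G x := by
  obtain ⟨f, hf, hu⟩ := h
  choose x hx using hu
  have hsub : ∀ v, f v ⊆ Set.Icc (x v) (x v + 1) := by
    intro v z hz
    rcases hx v with h | h | h | h <;> rw [h] at hz <;>
      exact ⟨by linarith [hz.1], by linarith [hz.2]⟩
  have hsup : ∀ v, Set.Ioo (x v) (x v + 1) ⊆ f v := by
    intro v z hz
    rcases hx v with h | h | h | h <;> rw [h] <;> constructor <;> linarith [hz.1, hz.2]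
  refine ⟨x, ?_, ?_, ?_⟩
  · intro u v huv
    obtain ⟨z, hz1, hz2⟩ := (hf u v huv.ne).1 huv
    have h1 := hsub u hz1
    have h2 := hsub v hz2
    rw [abs_le]
    constructor <;> linarith [h1.1, h1.2, h2.1, h2.2]
  · intro u v hne hna
    by_contra hlt
    push Not at hlt
    rw [abs_lt] at hlt
    apply hna
    rw [hf u v hne]
    refine ⟨(x u + x v + 1) / 2, hsup u ⟨?_, ?_⟩, hsup v ⟨?_, ?_⟩⟩ <;> linarith [hlt.1, hlt.2]
  · intro u u' v v' hu hv habs h1 h2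
    have hne : u ≠ v := by
      rintro rfl
      simp at habs
    rw [hf u v hne]
    obtain ⟨z, hz1, hz2⟩ := (hf u v' h1.ne).1 h1
    obtain ⟨w, hw1, hw2⟩ := (hf u' v h2.ne).1 h2
    have a1 := hsub u hz1
    have a2 := hsub v' hz2
    have a3 := hsub u' hw1
    have a4 := hsub v hw2
    have hzw : z = w := by
      rcases (abs_eq (by norm_num : (0 : ℝ) ≤ 1)).1 habs with h | h
      · have e1 : z = x u := by linarith [a1.1, a2.2]
        have e2 : w = x u := by linarith [a3.1, a4.2]
        rw [e1, e2]
      · have e1 : z = x v := by linarith [a1.2, a2.1]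
        have e2 : w = x v := by linarith [a3.2, a4.1]
        rw [e1, e2]
    exact ⟨z, hz1, hzw ▸ hw2⟩

theorem PosFun.comap {V W : Type*} {G : SimpleGraph V} {H : SimpleGraph W} {x : V → ℝ}
    (hx : PosFun G x) (f : W ↪ V) (hf : ∀ a b : W, H.Adj a b ↔ G.Adj (f a) (f b)) :
    PosFun H (x ∘ f) := by
  refine ⟨?_, ?_, ?_⟩
  · intro u v h
    exact hx.near _ _ ((hf _ _).1 h)
  · intro u v hne h
    exact hx.far _ _ (fun e => hne (f.injective e)) (fun e => h ((hf _ _).2 e))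
  · intro u u' v v' h1 h2 h3 h4 h5
    exact (hf _ _).2 (hx.rect _ (f u') _ (f v') h1 h2 h3 ((hf _ _).1 h4) ((hf _ _).1 h5))

theorem PosFun.neg {V : Type*} {G : SimpleGraph V} {x : V → ℝ} (hx : PosFun G x) :
    PosFun G (fun v => - x v) := by
  have key : ∀ u v, |-x u - -x v| = |x u - x v| := by
    intro u v
    rw [← abs_neg]
    congr 1
    ring
  refine ⟨?_, ?_, ?_⟩
  · intro u v h
    rw [key]
    exact hx.near _ _ h
  · intro u v hne h
    rw [key]
    exact hx.far _ _ hne h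
  · intro u u' v v' h1 h2 h3
    rw [key] at h3
    exact hx.rect _ _ _ _ (neg_injective h1) (neg_injective h2) h3

/-- Three pairwise distant reals close to `y` sum to `3 y`. -/
theorem three_sum {y a b c : ℝ} (ha : |y - a| ≤ 1) (hb : |y - b| ≤ 1) (hc : |y - c| ≤ 1)
    (hab : 1 ≤ |a - b|) (hac : 1 ≤ |a - c|) (hbc : 1 ≤ |b - c|) :
    (a = y ∨ a = y - 1 ∨ a = y + 1) ∧ a + b + c = 3 * y := by
  rw [abs_le] at ha hb hc
  rw [le_abs] at hab hac hbc
  rcases hab with h1 | h1 <;> rcases hac with h2 | h2 <;> rcases hbc with h3 | h3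
  · exact ⟨Or.inr (Or.inr (by linarith)), by linarith⟩
  · exact ⟨Or.inr (Or.inr (by linarith)), by linarith⟩
  · exfalso; linarith
  · exact ⟨Or.inl (by linarith), by linarith⟩
  · exact ⟨Or.inl (by linarith), by linarith⟩
  · exfalso; linarith
  · exact ⟨Or.inr (Or.inl (by linarith)), by linarith⟩
  · exact ⟨Or.inr (Or.inl (by linarith)), by linarith⟩

theorem PosFun.claw {V : Type*} {G : SimpleGraph V} {x : V → ℝ} (hx : PosFun G x)
    {y a b c : V} (ha : G.Adj y a) (hb : G.Adj y b) (hc : G.Adj y c)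
    (hab : ¬ G.Adj a b) (hac : ¬ G.Adj a c) (hbc : ¬ G.Adj b c)
    (nab : a ≠ b) (nac : a ≠ c) (nbc : b ≠ c) :
    (x a = x y ∨ x a = x y - 1 ∨ x a = x y + 1) ∧ x a + x b + x c = 3 * x y :=
  three_sum (hx.near _ _ ha) (hx.near _ _ hb) (hx.near _ _ hc) (hx.far _ _ nab hab)
    (hx.far _ _ nac hac) (hx.far _ _ nbc hbc)

/-- The propagation of positions along an (induced) gadget `Q_k`:
`p 0, ..., p k` is the path, `t 1, ..., t k` the triangle vertices, `a, b` the pendants. -/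
theorem PosFun.chain {V : Type*} {G : SimpleGraph V} {x : V → ℝ} (hx : PosFun G x)
    (k : ℕ) (hk : 1 ≤ k) (p t : ℕ → V) (a b : V)
    (hpp : ∀ i < k, G.Adj (p i) (p (i + 1)))
    (hpt : ∀ i < k, G.Adj (p i) (t (i + 1)))
    (hpp' : ∀ i, i + 2 ≤ k → ¬ G.Adj (p i) (p (i + 2)) ∧ p i ≠ p (i + 2))
    (hpt' : ∀ i, i + 2 ≤ k → ¬ G.Adj (p i) (t (i + 2)) ∧ p i ≠ t (i + 2))
    (htp' : ∀ i, 1 ≤ i → i + 1 ≤ k → ¬ G.Adj (t i) (p (i + 1)) ∧ t i ≠ p (i + 1))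
    (htt' : ∀ i, 1 ≤ i → i + 1 ≤ k → ¬ G.Adj (t i) (t (i + 1)) ∧ t i ≠ t (i + 1))
    (ha : G.Adj (p 0) a) (hb : G.Adj (p 0) b) (hab : ¬ G.Adj a b ∧ a ≠ b)
    (hap : ¬ G.Adj a (p 1) ∧ a ≠ p 1) (hat : ¬ G.Adj a (t 1) ∧ a ≠ t 1)
    (hbp : ¬ G.Adj b (p 1) ∧ b ≠ p 1) (hbt : ¬ G.Adj b (t 1) ∧ b ≠ t 1)
    (hw : ∃ w, (G.Adj w (p 1) ∧ ¬ G.Adj w (t 1) ∧ w ≠ t 1) ∨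
      (G.Adj w (t 1) ∧ ¬ G.Adj w (p 1) ∧ w ≠ p 1)) :
    ∃ e : ℝ, (e = 1 ∨ e = -1) ∧ ∀ i < k, x (p (i + 1)) = x (p i) + e ∧
      x (t (i + 1)) = x (p i) + e := by
  have c1 := hx.claw ha hb (hpp 0 (by omega)) hab.1 hap.1 hbp.1 hab.2 hap.2 hbp.2
  have c1' := hx.claw hb ha (hpp 0 (by omega)) (fun h => hab.1 h.symm) hbp.1 hap.1 hab.2.symm
    hbp.2 hap.2
  have c2 := hx.claw ha hb (hpt 0 (by omega)) hab.1 hat.1 hbt.1 hab.2 hat.2 hbt.2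
  have c3 := hx.claw (hpp 0 (by omega)) ha hb (fun h => hap.1 h.symm) (fun h => hbp.1 h.symm)
    hab.1 hap.2.symm hbp.2.symm hab.2
  simp only [zero_add] at *
  have e1 : x (p 1) = x (t 1) := by linarith [c1.2, c2.2]
  -- the middle position is impossible
  have key : ∀ y z, x y = x (p 0) → x z = x (p 0) → (¬ G.Adj a y ∧ a ≠ y) →
      (¬ G.Adj b y ∧ b ≠ y) → ∀ w, G.Adj w y → ¬ G.Adj w z → w ≠ z → False := by
    intro y z hy hz hay hby w h1 h2 h3
    have n1 := hx.near _ _ h1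
    have n2 := hx.far _ _ h3 h2
    rw [hz] at n2
    rw [hy] at n1
    have n3 : |x w - x (p 0)| = 1 := le_antisymm n1 n2
    have na := hx.far _ _ hay.2 hay.1
    have na' := hx.near _ _ ha
    have nb := hx.far _ _ hby.2 hby.1
    have nb' := hx.near _ _ hb
    have nab := hx.far _ _ hab.2 hab.1
    have pa : |x y - x a| = 1 := by
      rw [hy]
      rw [hy, abs_sub_comm] at na
      exact le_antisymm na' na
    have pb : |x y - x b| = 1 := by
      rw [hy]
      rw [hy, abs_sub_comm] at nb
      exact le_antisymm nb' nb
    have hcase : x w = x a ∨ x w = x b := by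
      rw [hy] at pa pb
      rcases (abs_eq (by norm_num : (0 : ℝ) ≤ 1)).1 n3 with h | h <;>
      rcases (abs_eq (by norm_num : (0 : ℝ) ≤ 1)).1 pa with h' | h' <;>
      rcases (abs_eq (by norm_num : (0 : ℝ) ≤ 1)).1 pb with h'' | h''
      · exfalso
        have : x a - x b = 0 := by linarith
        rw [this] at nab; norm_num at nab
      · right; linarith
      · left; linarith
      · exfalso
        have : x a - x b = 0 := by linarith
        rw [this] at nab; norm_num at nab
      · exfalso
        have : x a - x b = 0 := by linarith
        rw [this] at nab; norm_num at nab
      · left; linarith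
      · right; linarith
      · exfalso
        have : x a - x b = 0 := by linarith
        rw [this] at nab; norm_num at nab
    rcases hcase with h | h
    · exact hay.1 (hx.rect y (p 0) a w hy h.symm pa h1.symm ha).symm
    · exact hby.1 (hx.rect y (p 0) b w hy h.symm pb h1.symm hb).symm
  have hne : x (p 1) ≠ x (p 0) := by
    intro h
    obtain ⟨w, hw | hw⟩ := hw
    · exact key (p 1) (t 1) h (e1 ▸ h) hap hbp w hw.1 hw.2.1 hw.2.2
    · exact key (t 1) (p 1) (e1 ▸ h) h hat hbt w hw.1 hw.2.1 hw.2.2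
  obtain ⟨e, he, hpe⟩ : ∃ e : ℝ, (e = 1 ∨ e = -1) ∧ x (p 1) = x (p 0) + e := by
    rcases c3.1 with h | h | h
    · exact absurd h hne
    · exact ⟨-1, Or.inr rfl, by linarith⟩
    · exact ⟨1, Or.inl rfl, by linarith⟩
  refine ⟨e, he, ?_⟩
  intro i
  induction i with
  | zero =>
    intro _
    simp only [zero_add]
    exact ⟨hpe, by linarith⟩
  | succ i ih =>
    intro hi
    obtain ⟨ih1, ih2⟩ := ih (by omega)
    have step : ∀ z, G.Adj (p (i + 1)) z → ¬ G.Adj (t (i + 1)) z → t (i + 1) ≠ z →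
        ¬ G.Adj (p i) z → p i ≠ z → x z = x (p (i + 1)) + e := by
      intro z h1 h2 h3 h4 h5
      have n1 := hx.near _ _ h1
      have n2 := hx.far _ _ h3 h2
      have n3 := hx.far _ _ h5 h4
      rw [ih2, ← ih1] at n2
      rw [ih1] at n1 n2 ⊢
      have n4 : |x (p i) + e - x z| = 1 := le_antisymm n1 n2
      rcases he with rfl | rfl
      · rcases (abs_eq (by norm_num : (0 : ℝ) ≤ 1)).1 n4 with h | h
        · exfalso
          have : x (p i) - x z = 0 := by linarith
          rw [this] at n3; norm_num at n3
        · linarith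
      · rcases (abs_eq (by norm_num : (0 : ℝ) ≤ 1)).1 n4 with h | h
        · linarith
        · exfalso
          have : x (p i) - x z = 0 := by linarith
          rw [this] at n3; norm_num at n3
    have a1 := hpp' i (by omega)
    have a2 := hpt' i (by omega)
    have a3 := htp' (i + 1) (by omega) (by omega)
    have a4 := htt' (i + 1) (by omega) (by omega)
    exact ⟨step _ (hpp (i + 1) hi) a3.1 a3.2 a1.1 a1.2,
      step _ (hpt (i + 1) hi) a4.1 a4.2 a2.1 a2.2⟩

theorem PosFun.chainQ {V : Type*} {G : SimpleGraph V} {x : V → ℝ} (hx : PosFun G x)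
    (k : ℕ) (hk : 1 ≤ k) (g : QVert k → V)
    (hg : ∀ a b, a ≠ b → g a ≠ g b ∧ (G.Adj (g a) (g b) ↔ Qadj k a b ∨ Qadj k b a))
    (hw : k = 1 → ∃ w, (G.Adj w (g (Qspecial1 k)) ∧ ¬ G.Adj w (g (Qspecial2 k)) ∧
        w ≠ g (Qspecial2 k)) ∨
      (G.Adj w (g (Qspecial2 k)) ∧ ¬ G.Adj w (g (Qspecial1 k)) ∧ w ≠ g (Qspecial1 k))) :
    ∃ e : ℝ, (e = 1 ∨ e = -1) ∧
      x (g (Qspecial1 k)) = x (g (Sum.inl ⟨k - 1, by omega⟩)) + e ∧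
      x (g (Qspecial2 k)) = x (g (Sum.inl ⟨k - 1, by omega⟩)) + e := by
  have hs2 : Qspecial2 k = Sum.inr (Sum.inl ⟨k - 1, by omega⟩) := by
    unfold Qspecial2
    rw [dif_neg (by omega)]
  rw [hs2] at *
  unfold Qspecial1 at *
  let p : ℕ → V := fun i => g (Sum.inl ⟨min i k, by omega⟩)
  let t : ℕ → V := fun i => g (Sum.inr (Sum.inl ⟨min (i - 1) (k - 1), by omega⟩))
  let a : V := g (Sum.inr (Sum.inr 0))
  let b : V := g (Sum.inr (Sum.inr 1))
  have aux : ∀ a b, a ≠ b → (Qadj k a b ∨ Qadj k b a) → G.Adj (g a) (g b) :=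
    fun a b h h' => ((hg a b h).2).2 h'
  have aux' : ∀ a b, a ≠ b → ¬ (Qadj k a b ∨ Qadj k b a) → ¬ G.Adj (g a) (g b) ∧ g a ≠ g b :=
    fun a b h h' => ⟨fun h'' => h' (((hg a b h).2).1 h''), (hg a b h).1⟩
  have main := hx.chain k hk p t a b ?_ ?_ ?_ ?_ ?_ ?_ ?_ ?_ ?_ ?_ ?_ ?_ ?_ ?_
  · obtain ⟨e, he, h⟩ := main
    refine ⟨e, he, ?_⟩
    have h1 := h (k - 1) (by omega)
    have e1 : k - 1 + 1 = k := by omega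
    rw [e1] at h1
    have e2 : p k = g (Sum.inl (Fin.last k)) := by
      simp only [p]
      congr 2
      ext
      simp
    have e3 : p (k - 1) = g (Sum.inl ⟨k - 1, by omega⟩) := by
      simp only [p]
      congr 2
      ext
      simp
    have e4 : t k = g (Sum.inr (Sum.inl ⟨k - 1, by omega⟩)) := by
      simp only [t]
      congr 3
      ext
      simp
    rw [e2, e3, e4] at h1
    exact h1
  all_goals try intro i
  all_goals try intro hi
  all_goals try intro hi'
  · refine aux _ _ ?_ ?_ <;> simp [Qadj] <;> omega
  · refine aux _ _ ?_ ?_ <;> simp [Qadj] <;> omega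
  · refine aux' _ _ ?_ ?_ <;> simp [Qadj] <;> omega
  · refine aux' _ _ ?_ ?_ <;> simp [Qadj] <;> omega
  · refine aux' _ _ ?_ ?_ <;> simp [Qadj] <;> omega
  · refine aux' _ _ ?_ ?_ <;> simp [Qadj] <;> omega
  · refine aux _ _ ?_ ?_ <;> simp [Qadj]
  · refine aux _ _ ?_ ?_ <;> simp [Qadj]
  · refine aux' _ _ ?_ ?_ <;> simp [Qadj]
  · refine aux' _ _ ?_ ?_ <;> simp [Qadj] <;> omega
  · refine aux' _ _ ?_ ?_ <;> simp [Qadj] <;> omega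
  · refine aux' _ _ ?_ ?_ <;> simp [Qadj] <;> omega
  · refine aux' _ _ ?_ ?_ <;> simp [Qadj] <;> omega
  · by_cases h1 : k = 1
    · subst h1
      exact hw rfl
    · refine ⟨p 2, Or.inl ⟨?_, ?_⟩⟩
      · refine aux _ _ ?_ ?_ <;> simp [Qadj] <;> omega
      · refine aux' _ _ ?_ ?_ <;> simp [Qadj] <;> omega

theorem four_points {y a b c d : ℝ} (ha : |y - a| ≤ 1) (hb : |y - b| ≤ 1) (hc : |y - c| ≤ 1)
    (hd : |y - d| ≤ 1)
    (hab : 1 ≤ |a - b|) (hac : 1 ≤ |a - c|) (hbc : 1 ≤ |b - c|)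
    (had : 1 ≤ |a - d|) (hbd : 1 ≤ |b - d|) (hcd : 1 ≤ |c - d|) : False := by
  have h1 := (three_sum ha hb hc hab hac hbc).2
  have h2 := (three_sum ha hb hd hab had hbd).2
  have : c - d = 0 := by linarith
  rw [this] at hcd
  norm_num at hcd

theorem not_posFun_R (k : ℕ) (x) : ¬ PosFun (Rgraph k) x := by
  intro hx
  have adj : ∀ a b, (Rgraph k).Adj a b ↔ a ≠ b ∧ (Radj k a b ∨ Radj k b a) :=
    fun a b => SimpleGraph.fromRel_adj _ _ _
  have near : ∀ a b, a ≠ b → (Radj k a b ∨ Radj k b a) → |x a - x b| ≤ 1 := 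
    fun a b h h' => hx.near a b ((adj a b).2 ⟨h, h'⟩)
  have far : ∀ a b, a ≠ b → ¬ (Radj k a b ∨ Radj k b a) → 1 ≤ |x a - x b| := 
    fun a b h h' => hx.far a b h (fun h'' => h' ((adj a b).1 h'').2)
  rcases Nat.eq_zero_or_pos k with rfl | hk
  · refine four_points (y := x (Sum.inl 1)) (a := x (Sum.inl 0)) (b := x (Sum.inl 2))
      (c := x (Sum.inr (Sum.inr 0))) (d := x (Sum.inr (Sum.inr 1))) ?_ ?_ ?_ ?_ ?_ ?_ ?_ ?_ ?_ ?_
    all_goals first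
      | (apply near <;> simp [Radj]; done)
      | (apply far <;> simp [Radj]; done)
  · let g : QVert k → Fin (k + 3) ⊕ (Fin k ⊕ Fin 2) := fun v => match v with
      | Sum.inl m => Sum.inl ⟨m + 1, by omega⟩
      | Sum.inr (Sum.inl i) => Sum.inr (Sum.inl i)
      | Sum.inr (Sum.inr j) => if j = 0 then Sum.inl 0 else Sum.inr (Sum.inr 0)
    have hs2 : Qspecial2 k = Sum.inr (Sum.inl ⟨k - 1, by omega⟩) := by
      unfold Qspecial2
      rw [dif_neg (by omega)]
    have ch := hx.chainQ k hk g ?_ ?_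
    · obtain ⟨e, he, h1, h2⟩ := ch
      rw [hs2] at h2
      simp only [Qspecial1, g, Fin.val_last] at h1 h2
      have s1 := (three_sum (y := x (Sum.inl ⟨k + 1, by omega⟩)) (a := x (Sum.inl ⟨k + 2, by omega⟩))
        (b := x (Sum.inr (Sum.inr 1))) (c := x (Sum.inl ⟨k - 1 + 1, by omega⟩)) ?_ ?_ ?_ ?_ ?_ ?_).2
      have s2 := (three_sum (y := x (Sum.inl ⟨k + 1, by omega⟩)) (a := x (Sum.inl ⟨k + 2, by omega⟩))
        (b := x (Sum.inr (Sum.inr 1))) (c := x (Sum.inr (Sum.inl ⟨k - 1, by omega⟩)))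
          ?_ ?_ ?_ ?_ ?_ ?_).2
      · rcases he with rfl | rfl <;> linarith
      all_goals first
      | (apply near <;> simp [Radj] <;> omega; done)
      | (apply far <;> simp [Radj] <;> omega; done)
      | skip
    · rintro (a | a | a) (b | b | b) hab
      all_goals try (fin_cases a)
      all_goals try (fin_cases b)
      all_goals simp [g, adj, Radj, Qadj] at hab ⊢
      all_goals first 
        | omega 
        | skip
    · rintro rfl
      refine ⟨Sum.inl 3, Or.inl ?_⟩
      rw [hs2]
      simp [g, adj, Radj, Qspecial1]

theorem PosFun.not_S {V : Type*} {G : SimpleGraph V} {x : V → ℝ} (hx : PosFun G x)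
    (k : ℕ) (hk : 1 ≤ k) (g : QVert k → V)
    (hg : ∀ a b, a ≠ b → g a ≠ g b ∧ (G.Adj (g a) (g b) ↔ Qadj k a b ∨ Qadj k b a))
    (z : V) (h1 : G.Adj z (g (Qspecial2 k))) (h2 : G.Adj z (g (Sum.inl ⟨k - 1, by omega⟩)))
    (h3 : ¬ G.Adj z (g (Qspecial1 k))) (h4 : z ≠ g (Qspecial1 k)) : False := by
  obtain ⟨e, he, e1, e2⟩ := hx.chainQ k hk g hg (fun _ => ⟨z, Or.inr ⟨h1, h3, h4⟩⟩)
  have n1 := hx.near _ _ h1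
  have n2 := hx.near _ _ h2
  have n3 := hx.far _ _ h4 h3
  have hadj : G.Adj (g (Sum.inl ⟨k - 1, by omega⟩)) (g (Qspecial1 k)) := by
    refine ((hg _ _ ?_).2).2 (Or.inl ?_)
    · simp only [Qspecial1, ne_eq, Sum.inl.injEq, Fin.ext_iff, Fin.val_last]
      omega
    · simp only [Qspecial1, Qadj, Fin.val_last]
      omega
  have hz : x z = x (g (Sum.inl ⟨k - 1, by omega⟩)) := by
    rw [e2] at n1
    rw [e1] at n3
    rw [abs_le] at n1 n2
    rw [le_abs] at n3
    rcases he with rfl | rfl <;> rcases n3 with n3 | n3 <;> linarith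
  refine h3 (hx.rect z (g (Sum.inl ⟨k - 1, by omega⟩)) _ (g (Qspecial2 k)) hz (by rw [e1, e2])
    ?_ h1 hadj)
  rw [hz, e1]
  rcases he with rfl | rfl <;> norm_num

theorem not_posFun_S (k : ℕ) (hk : 1 ≤ k) (x) : ¬ PosFun (Sgraph k) x := by
  intro hx
  have adj : ∀ a b, (Sgraph k).Adj a b ↔ a ≠ b ∧ (Sadj k a b ∨ Sadj k b a) :=
    fun a b => SimpleGraph.fromRel_adj _ _ _
  have hs2 : Qspecial2 k = Sum.inr (Sum.inl ⟨k - 1, by omega⟩) := by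
    unfold Qspecial2
    rw [dif_neg (by omega)]
  refine hx.not_S k hk Sum.inl ?_ (Sum.inr ()) ?_ ?_ ?_ ?_
  · intro a b hab
    simp [adj, Sadj, hab]
  · simp [adj, Sadj]
  · simp [adj, Sadj]
  · rw [adj]
    unfold Sadj Sextra Qspecial1
    rw [hs2]
    split_ifs <;> simp [Fin.ext_iff]
    all_goals omega
  · simp

theorem not_posFun_S'' (k : ℕ) (hk : 2 ≤ k) (x) : ¬ PosFun (S''graph k) x := by
  intro hx
  have adj : ∀ a b, (S''graph k).Adj a b ↔ a ≠ b ∧ (S''adj k a b ∨ S''adj k b a) :=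
    fun a b => SimpleGraph.fromRel_adj _ _ _
  have hs2 : Qspecial2 k = Sum.inr (Sum.inl ⟨k - 1, by omega⟩) := by
    unfold Qspecial2
    rw [dif_neg (by omega)]
  refine hx.not_S k (by omega) Sum.inl ?_ (Sum.inr ()) ?_ ?_ ?_ ?_
  · intro a b hab
    simp [adj, S''adj, hab]
  · simp [adj, S''adj]
  · simp [adj, S''adj]
  · rw [adj]
    unfold S''adj Sextra Qspecial1
    rw [hs2]
    split_ifs <;> simp [Fin.ext_iff]
    all_goals omega
  · simp

theorem three_cases {y a b c : ℝ} (ha : |y - a| ≤ 1) (hb : |y - b| ≤ 1) (hc : |y - c| ≤ 1)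
    (hab : 1 ≤ |a - b|) (hac : 1 ≤ |a - c|) (hbc : 1 ≤ |b - c|) :
    (a = y ∧ b = y - 1 ∧ c = y + 1) ∨ (a = y ∧ b = y + 1 ∧ c = y - 1) ∨
    (b = y ∧ a = y - 1 ∧ c = y + 1) ∨ (b = y ∧ a = y + 1 ∧ c = y - 1) ∨
    (c = y ∧ a = y - 1 ∧ b = y + 1) ∨ (c = y ∧ a = y + 1 ∧ b = y - 1) := by
  rw [abs_le] at ha hb hc
  rw [le_abs] at hab hac hbc
  rcases hab with h1 | h1 <;> rcases hac with h2 | h2 <;> rcases hbc with h3 | h3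
  · exact Or.inr (Or.inr (Or.inr (Or.inl (by refine ⟨?_, ?_, ?_⟩ <;> linarith))))
  · exact Or.inr (Or.inr (Or.inr (Or.inr (Or.inr (by refine ⟨?_, ?_, ?_⟩ <;> linarith)))))
  · exfalso; linarith
  · exact Or.inl (by refine ⟨?_, ?_, ?_⟩ <;> linarith)
  · exact Or.inr (Or.inl (by refine ⟨?_, ?_, ?_⟩ <;> linarith))
  · exfalso; linarith
  · exact Or.inr (Or.inr (Or.inr (Or.inr (Or.inl (by refine ⟨?_, ?_, ?_⟩ <;> linarith)))))
  · exact Or.inr (Or.inr (Or.inl (by refine ⟨?_, ?_, ?_⟩ <;> linarith)))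

theorem not_posFun_G1 (x) : ¬ PosFun G1 x := by
  intro hx
  have near : ∀ a b, G1.Adj a b → |x a - x b| ≤ 1 := hx.near
  have far := hx.far
  have s1 := (three_sum (y := x 0) (a := x 2) (b := x 3) (c := x 4) ?_ ?_ ?_ ?_ ?_ ?_)
  have s2 := (three_sum (y := x 1) (a := x 2) (b := x 3) (c := x 4) ?_ ?_ ?_ ?_ ?_ ?_)
  have s3 := (three_sum (y := x 0) (a := x 5) (b := x 3) (c := x 4) ?_ ?_ ?_ ?_ ?_ ?_)
  · have e1 : x 0 = x 1 := by linarith [s1.2, s2.2]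
    have e2 : x 5 = x 2 := by linarith [s1.2, s3.2]
    have n0 : 1 ≤ |x 1 - x 5| := by
      apply far <;> simp [G1]
    have n1 : |x 0 - x 5| ≤ 1 := by
      apply near; simp [G1]
    have := hx.rect 1 0 5 2 e1.symm e2 (by rw [e1] at n1; exact le_antisymm n1 n0)
      (by simp [G1]) (by simp [G1])
    simp [G1] at this
  all_goals first
    | (apply near; simp [G1]; done)
    | (apply far <;> simp [G1]; done)

theorem not_posFun_T (i j : ℕ) (hij : j ≤ i) (x) : ¬ PosFun (Tgraph i j) x := by
  intro hx
  have adj : ∀ a b, (Tgraph i j).Adj a b ↔ a ≠ b ∧ (Tadj i j a b ∨ Tadj i j b a) :=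
    fun a b => SimpleGraph.fromRel_adj _ _ _
  have near : ∀ a b, a ≠ b → (Tadj i j a b ∨ Tadj i j b a) → |x a - x b| ≤ 1 := 
    fun a b h h' => hx.near a b ((adj a b).2 ⟨h, h'⟩)
  have far : ∀ a b, a ≠ b → ¬ (Tadj i j a b ∨ Tadj i j b a) → 1 ≤ |x a - x b| := 
    fun a b h h' => hx.far a b h (fun h'' => h' ((adj a b).1 h'').2)
  have hss : ∀ k, Qspecial2 k ≠ Qspecial1 k := by
    intro k
    unfold Qspecial2 Qspecial1
    split_ifs <;> simp
  have c1 : (Tgraph i j).Adj (Sum.inl (Qspecial1 i)) (Sum.inr (Qspecial1 j)) := by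
    simp [adj, Tadj]
  have c2 : (Tgraph i j).Adj (Sum.inl (Qspecial1 i)) (Sum.inr (Qspecial2 j)) := by
    simp [adj, Tadj]
  have c3 : (Tgraph i j).Adj (Sum.inl (Qspecial2 i)) (Sum.inr (Qspecial1 j)) := by
    simp [adj, Tadj]
  have c4 : ¬ (Tgraph i j).Adj (Sum.inl (Qspecial2 i)) (Sum.inr (Qspecial2 j)) := by
    simp [adj, Tadj, hss]
  have d4 := hx.far _ _ (by simp) c4
  have hgl : ∀ a b : QVert i, a ≠ b → (Sum.inl a : QVert i ⊕ QVert j) ≠ Sum.inl b ∧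
      ((Tgraph i j).Adj (Sum.inl a) (Sum.inl b) ↔ Qadj i a b ∨ Qadj i b a) := by
    intro a b hab
    simp [adj, Tadj, hab]
  have hgr : ∀ a b : QVert j, a ≠ b → (Sum.inr a : QVert i ⊕ QVert j) ≠ Sum.inr b ∧
      ((Tgraph i j).Adj (Sum.inr a) (Sum.inr b) ↔ Qadj j a b ∨ Qadj j b a) := by
    intro a b hab
    simp [adj, Tadj, hab]
  -- the concluding rectangle
  have fin : x (Sum.inl (Qspecial1 i)) = x (Sum.inl (Qspecial2 i)) →
      x (Sum.inr (Qspecial1 j)) = x (Sum.inr (Qspecial2 j)) → False := by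
    intro e1 e2
    have n := hx.near _ _ c1
    rw [e1, e2] at n
    exact c4 (hx.rect _ _ _ _ e1.symm e2.symm (le_antisymm n d4) c3 c2)
  rcases Nat.eq_zero_or_pos i with rfl | hi
  · have hj : j = 0 := by omega
    subst hj
    have e0 : Qspecial1 0 = Sum.inl 0 := rfl
    have e1 : Qspecial2 0 = Sum.inr (Sum.inr 1) := rfl
    simp only [e0, e1] at c1 c2 c3 c4 d4 fin
    have s1 := (three_cases (y := x (Sum.inl (Sum.inl 0))) (a := x (Sum.inl (Sum.inr (Sum.inr 0))))
      (b := x (Sum.inl (Sum.inr (Sum.inr 1)))) (c := x (Sum.inr (Sum.inr (Sum.inr 1))))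
        ?_ ?_ ?_ ?_ ?_ ?_)
    have s2 := (three_cases (y := x (Sum.inr (Sum.inl 0))) (a := x (Sum.inr (Sum.inr (Sum.inr 0))))
      (b := x (Sum.inl (Sum.inr (Sum.inr 1)))) (c := x (Sum.inr (Sum.inr (Sum.inr 1))))
        ?_ ?_ ?_ ?_ ?_ ?_)
    · have aa : 1 ≤ |x (Sum.inl (Sum.inr (Sum.inr 0))) - x (Sum.inr (Sum.inr (Sum.inr 0)))| := by
        apply far <;> simp [Tadj, e0, e1]
      have fin2 : x (Sum.inl (Sum.inr (Sum.inr 1))) = x (Sum.inr (Sum.inl 0)) →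
          x (Sum.inr (Sum.inr (Sum.inr 1))) = x (Sum.inl (Sum.inl 0)) → False := by
        intro h1 h2
        have n := hx.near _ _ c1
        rw [← h1, ← h2, abs_sub_comm] at n
        exact c4 (hx.rect _ _ _ _ h1 h2 (le_antisymm n d4) (by simp [adj, Tadj, Qadj])
          (by simp [adj, Tadj, Qadj]))
      have n := hx.near _ _ c1
      rw [abs_le] at n
      rw [le_abs] at aa
      rcases s1 with s1 | s1 | s1 | s1 | s1 | s1 <;>
      rcases s2 with s2 | s2 | s2 | s2 | s2 | s2 <;>
      first
      | (exfalso; rcases aa with aa | aa <;> linarith)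
      | (apply fin <;> linarith)
      | (apply fin2 <;> linarith)
    all_goals first
    | (apply near <;> simp [Tadj, Qadj, e0, e1]; done)
    | (apply far <;> simp [Tadj, Qadj, e0, e1]; done)
  · have hs2 : Qspecial2 i = Sum.inr (Sum.inl ⟨i - 1, by omega⟩) := by
      unfold Qspecial2
      rw [dif_neg (by omega)]
    obtain ⟨e, he, h1, h2⟩ := hx.chainQ i hi Sum.inl hgl (fun _ => ⟨Sum.inr (Qspecial2 j),
      Or.inl ⟨c2.symm, fun h => c4 h.symm, by simp⟩⟩)
    rcases Nat.eq_zero_or_pos j with rfl | hj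
    · have e0 : Qspecial1 0 = Sum.inl 0 := rfl
      have e1 : Qspecial2 0 = Sum.inr (Sum.inr 1) := rfl
      have s1 := (three_cases (y := x (Sum.inr (Sum.inl 0))) (a := x (Sum.inr (Sum.inr (Sum.inr 0))))
        (b := x (Sum.inr (Sum.inr (Sum.inr 1)))) (c := x (Sum.inl (Qspecial2 i)))
        ?_ ?_ ?_ ?_ ?_ ?_)
      · have m1 := hx.near _ _ c2
        have m2 : 1 ≤ |x (Sum.inr (Sum.inr (Sum.inr 0))) - x (Sum.inl (Sum.inl ⟨i - 1, by omega⟩))| := by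
          apply far
          · simp
          · simp only [Tadj, e0, e1, hs2, Qspecial1]
            simp
        have m3 : 1 ≤ |x (Sum.inr (Sum.inr (Sum.inr 1))) - x (Sum.inl (Sum.inl ⟨i - 1, by omega⟩))| := by
          apply far
          · simp
          · simp only [Tadj, e0, e1, hs2, Qspecial1]
            simp [Fin.ext_iff]
            omega
        rw [e1] at m1
        rw [e0, e1] at fin
        rw [abs_le] at m1
        rw [le_abs] at m2 m3
        rcases he with rfl | rfl <;>
        rcases s1 with s1 | s1 | s1 | s1 | s1 | s1 <;>
        first
        | (exfalso; linarith)
        | (exfalso; rcases m2 with m2 | m2 <;> linarith)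
        | (exfalso; rcases m3 with m3 | m3 <;> linarith)
        | (apply fin <;> linarith)
      all_goals first
      | (apply near <;> simp [Tadj, Qadj, e0, e1]; done)
      | (apply far <;> simp [Tadj, Qadj, e0, e1, hss]; done)
    · obtain ⟨e', he', h1', h2'⟩ := hx.chainQ j hj Sum.inr hgr (fun _ => ⟨Sum.inl (Qspecial2 i),
        Or.inl ⟨c3, c4, by simp⟩⟩)
      exact fin (by rw [h1, h2]) (by rw [h1', h2'])

theorem intervalGraph_of_mixed {V : Type*} [Finite V] {G : SimpleGraph V}
    (h : MixedUnitIntervalGraph G) : IsIntervalGraph G := by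
  classical
  obtain ⟨f, hf, hu⟩ := h
  have hne : ∀ v, (f v).Nonempty := by
    intro v
    obtain ⟨x, hx⟩ := hu v
    refine ⟨x + 1 / 2, ?_⟩
    rcases hx with h | h | h | h <;> rw [h] <;> constructor <;> linarith
  have hoc : ∀ v, (f v).OrdConnected := by
    intro v
    obtain ⟨x, hx⟩ := hu v
    rcases hx with h | h | h | h <;> rw [h]
    · exact Set.ordConnected_Icc
    · exact Set.ordConnected_Ioo
    · exact Set.ordConnected_Ioc
    · exact Set.ordConnected_Ico
  let pt : V × V → ℝ := fun p => if h : (f p.1 ∩ f p.2).Nonempty then h.some else 0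
  have hpt : ∀ u v, (f u ∩ f v).Nonempty → pt (u, v) ∈ f u ∩ f v := by
    intro u v h
    simp only [pt]
    rw [dif_pos h]
    exact h.some_mem
  let S : V → Set ℝ := fun v => Set.range pt ∩ f v
  have hSf : ∀ v, (S v).Finite := fun v => (Set.finite_range pt).inter_of_left _
  have hSn : ∀ v, (S v).Nonempty := by
    intro v
    have := hpt v v (by rw [Set.inter_self]; exact hne v)
    exact ⟨pt (v, v), ⟨(v, v), rfl⟩, this.1⟩
  have hsub : ∀ v, Set.Icc (sInf (S v)) (sSup (S v)) ⊆ f v := by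
    intro v
    exact (hoc v).out ((hSn v).csInf_mem (hSf v)).2 ((hSn v).csSup_mem (hSf v)).2
  have hin : ∀ v, S v ⊆ Set.Icc (sInf (S v)) (sSup (S v)) := by
    intro v z hz
    exact ⟨csInf_le (hSf v).bddBelow hz, le_csSup (hSf v).bddAbove hz⟩
  refine ⟨fun v => Set.Icc (sInf (S v)) (sSup (S v)), ?_, fun v => ⟨_, _, rfl⟩⟩
  intro u v huv
  rw [hf u v huv]
  constructor
  · intro h
    have := hpt u v h
    exact ⟨pt (u, v), hin u ⟨⟨_, rfl⟩, this.1⟩, hin v ⟨⟨_, rfl⟩, this.2⟩⟩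
  · rintro ⟨z, h1, h2⟩
    exact ⟨z, hsub u h1, hsub v h2⟩

theorem mixed_forward {V : Type*} [Fintype V] (G : SimpleGraph V)
    (h : MixedUnitIntervalGraph G) :
      (IsIntervalGraph G ∧
       ¬ HasInducedSubgraph G G1 ∧
       (∀ i : ℕ, ¬ HasInducedSubgraph G (Rgraph i)) ∧
       (∀ i : ℕ, 1 ≤ i → ¬ HasInducedSubgraph G (Sgraph i)) ∧
       (∀ i : ℕ, 2 ≤ i → ¬ HasInducedSubgraph G (S''graph i)) ∧
       (∀ i j : ℕ, j ≤ i → ¬ HasInducedSubgraph G (Tgraph i j))) := by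
  obtain ⟨x, hx⟩ := exists_posFun h
  refine ⟨intervalGraph_of_mixed h, ?_, ?_, ?_, ?_, ?_⟩
  · rintro ⟨f, hf⟩
    exact not_posFun_G1 _ (hx.comap f hf)
  · rintro i ⟨f, hf⟩
    exact not_posFun_R _ _ (hx.comap f hf)
  · rintro i hi ⟨f, hf⟩
    exact not_posFun_S _ hi _ (hx.comap f hf)
  · rintro i hi ⟨f, hf⟩
    exact not_posFun_S'' _ hi _ (hx.comap f hf)
  · rintro i j hij ⟨f, hf⟩
    exact not_posFun_T _ _ hij _ (hx.comap f hf)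

/-! ### Reverse direction: closed interval representations -/

/-- A representation of `G` by nonempty closed intervals `[L v, R v]`. -/
structure CRep {V : Type*} (G : SimpleGraph V) (L R : V → ℝ) : Prop where
  le : ∀ v, L v ≤ R v
  adj : ∀ u v, u ≠ v → (G.Adj u v ↔ L u ≤ R v ∧ L v ≤ R u)

/-- The two intervals intersect. -/
def Ov {V : Type*} (L R : V → ℝ) (u v : V) : Prop := L u ≤ R v ∧ L v ≤ R u

theorem Ov.symm' {V : Type*} {L R : V → ℝ} {u v : V} : Ov L R u v ↔ Ov L R v u := by
  unfold Ov; tauto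

/-- A chain of `n` strictly-left-of steps from `a` to `b`. -/
def UpN {V : Type*} (L R : V → ℝ) : ℕ → V → V → Prop
  | 0, a, b => a = b
  | n + 1, a, b => ∃ c, UpN L R n a c ∧ R c < L b

/-- A chain of `n` down steps from `a` to `b`. -/
def DnN {V : Type*} (L R : V → ℝ) : ℕ → V → V → Prop
  | 0, a, b => a = b
  | n + 1, a, b => ∃ c, DnN L R n a c ∧ L c ≤ R b

/-- A loose down step. -/
def Loose {V : Type*} (L R : V → ℝ) (a b : V) : Prop :=
  ∃ s t, R s < L t ∧ L a ≤ R s ∧ L t ≤ R b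

section
variable {V : Type*} {L R : V → ℝ}

theorem UpN.trans {m n : ℕ} {a b c : V} (h1 : UpN L R m a b) (h2 : UpN L R n b c) :
    UpN L R (m + n) a c := by
  induction n generalizing c with
  | zero => cases h2; exact h1
  | succ n ih =>
    obtain ⟨d, hd, h⟩ := h2
    exact ⟨d, ih hd, h⟩

theorem UpN.one {a b : V} (h : R a < L b) : UpN L R 1 a b := ⟨a, rfl, h⟩

theorem DnN.trans {m n : ℕ} {a b c : V} (h1 : DnN L R m a b) (h2 : DnN L R n b c) :
    DnN L R (m + n) a c := by
  induction n generalizing c with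
  | zero => cases h2; exact h1
  | succ n ih =>
    obtain ⟨d, hd, h⟩ := h2
    exact ⟨d, ih hd, h⟩

theorem DnN.one {a b : V} (h : L a ≤ R b) : DnN L R 1 a b := ⟨a, rfl, h⟩

theorem Loose.dn {a b : V} (h : Loose L R a b) : L a ≤ R b := by
  obtain ⟨s, t, h1, h2, h3⟩ := h
  linarith

/-- Segments of an up chain given by a function. -/
theorem upN_seg {N : ℕ} {c : ℕ → V} (hc : ∀ i < N, R (c i) < L (c (i + 1))) (i d j : ℕ)
    (h : i + d = j) (hj : j ≤ N) : UpN L R d (c i) (c j) := by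
  induction d generalizing j with
  | zero =>
    obtain rfl : i = j := by omega
    rfl
  | succ d ih =>
    obtain rfl : j = (i + d) + 1 := by omega
    exact ⟨c (i + d), ih (i + d) rfl (by omega), hc _ (by omega)⟩

theorem dnN_seg {N : ℕ} {q : ℕ → V} (hq : ∀ i < N, L (q (i + 1)) ≤ R (q i)) (i d j : ℕ)
    (h : i + d = j) (hj : j ≤ N) : DnN L R d (q j) (q i) := by
  induction d generalizing i with
  | zero =>
    obtain rfl : i = j := by omega
    rfl
  | succ d ih =>
    exact ⟨q (i + 1), ih (i + 1) (by omega), hq _ (by omega)⟩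

theorem UpN.exists_fun {n : ℕ} {a b : V} (h : UpN L R n a b) :
    ∃ c : ℕ → V, c 0 = a ∧ c n = b ∧ ∀ i < n, R (c i) < L (c (i + 1)) := by
  induction n generalizing b with
  | zero => cases h; exact ⟨fun _ => a, rfl, rfl, by simp⟩
  | succ n ih =>
    obtain ⟨d, hd, h⟩ := h
    obtain ⟨c, h0, h1, h2⟩ := ih hd
    refine ⟨fun i => if i ≤ n then c i else b, by simp [h0], by simp, ?_⟩
    intro i hi
    rcases Nat.lt_or_ge i n with h' | h'
    · simp only [h'.le, if_true, Nat.succ_le_of_lt h']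
      exact h2 i h'
    · obtain rfl : i = n := by omega
      simp only [le_refl, if_true]
      rw [if_neg (by omega), h1]
      exact h

theorem DnN.exists_fun {n : ℕ} {a b : V} (h : DnN L R n b a) :
    ∃ q : ℕ → V, q 0 = a ∧ q n = b ∧ ∀ i < n, L (q (i + 1)) ≤ R (q i) := by
  induction n generalizing a with
  | zero => cases h; exact ⟨fun _ => b, rfl, rfl, by simp⟩
  | succ n ih =>
    obtain ⟨d, hd, h⟩ := h
    obtain ⟨c, h0, h1, h2⟩ := ih hd
    refine ⟨fun i => if i = 0 then a else c (i - 1), by simp, by simp [h1], ?_⟩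
    intro i hi
    rcases Nat.eq_zero_or_pos i with rfl | h'
    · simp [h0, h]
    · simp only [Nat.succ_ne_zero, if_false, Nat.add_sub_cancel]
      rw [if_neg (by omega)]
      have := h2 (i - 1) (by omega)
      rwa [show i - 1 + 1 = i by omega] at this

theorem up_lt {N : ℕ} {c : ℕ → V} (hle : ∀ v, L v ≤ R v)
    (hc : ∀ i < N, R (c i) < L (c (i + 1))) (i j : ℕ)
    (h : i < j) (hj : j ≤ N) : R (c i) < L (c j) := by
  induction j with
  | zero => omega
  | succ j ih =>
    rcases Nat.lt_or_ge i j with h' | h'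
    · have := ih h' (by omega)
      linarith [hle (c j), hc j (by omega)]
    · obtain rfl : i = j := by omega
      exact hc i (by omega)

theorem UpN.shrink (hle : ∀ v, L v ≤ R v) {n : ℕ} {a b : V} (h : UpN L R n a b) (m : ℕ)
    (hm : 1 ≤ m) (hmn : m ≤ n) : UpN L R m a b := by
  obtain ⟨c, h0, h1, h2⟩ := h.exists_fun
  have h3 := upN_seg h2 0 (m - 1) (m - 1) (by omega) (by omega)
  have h4 := up_lt hle h2 (m - 1) n (by omega) le_rfl
  rw [h0] at h3
  rw [h1] at h4
  have := h3.trans (UpN.one h4)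
  rwa [show m - 1 + 1 = m by omega] at this

theorem induced_of {G : SimpleGraph V} (hR : CRep G L R) {W : Type*} (r : W → W → Prop) (g : W → V)
    (h : ∀ a b, a ≠ b → g a ≠ g b ∧ (r a b ∨ r b a ↔ Ov L R (g a) (g b))) :
    HasInducedSubgraph G (SimpleGraph.fromRel r) := by
  have inj : Function.Injective g := by
    intro a b hab
    by_contra hne
    exact (h a b hne).1 hab
  refine ⟨⟨g, inj⟩, ?_⟩
  intro a b
  rw [SimpleGraph.fromRel_adj]
  by_cases hab : a = b
  · subst hab; simp
  · have := h a b hab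
    simp only [Function.Embedding.coeFn_mk]
    rw [hR.adj _ _ this.1, this.2]
    simp [hab, Ov]

end

/-- Lemma R. -/
theorem lemmaR {V : Type*} {G : SimpleGraph V} (hG : ∀ i : ℕ, ¬ HasInducedSubgraph G (Rgraph i))
    {L R : V → ℝ} (hrep : CRep G L R) (m n : ℕ) (hmn : m < n) (a b : V)
    (hu : UpN L R n a b) (hd : DnN L R m b a) : False := by
  induction m using Nat.strong_induction_on generalizing n a b with
  | _ m IH =>
  have hle := hrep.le
  have hu1 := hu.shrink hle (m + 1) (by omega) (by omega)
  clear hu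
  rcases Nat.lt_or_ge m 2 with hm | hm
  · interval_cases m
    · cases hd
      obtain ⟨c, hc, h⟩ := hu1
      cases hc
      linarith [hle a]
    · obtain ⟨c, hc, h⟩ := hu1
      obtain ⟨c', hc', h'⟩ := hc
      cases hc'
      obtain ⟨c'', hc'', h''⟩ := hd
      cases hc''
      linarith [hle c]
  obtain ⟨c, c0, cm, hc⟩ := hu1.exists_fun
  obtain ⟨q, q0, qm, hq⟩ := hd.exists_fun
  have clt := up_lt hle hc
  -- facts by induction
  have F1 : ∀ i, 1 ≤ i → i ≤ m - 1 → L (q i) ≤ R (c i) := by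
    intro i h1 h2
    by_contra h
    push Not at h
    have u := (upN_seg hc 0 i i (by omega) (by omega)).trans (UpN.one h)
    have d := dnN_seg hq 0 i i (by omega) (by omega)
    rw [c0] at u
    rw [q0] at d
    exact IH i (by omega) _ (by omega) _ _ u d
  have F2 : ∀ i, 1 ≤ i → i ≤ m - 1 → L (c (i + 1)) ≤ R (q i) := by
    intro i h1 h2
    by_contra h
    push Not at h
    have u := (UpN.one h).trans (upN_seg hc (i + 1) (m - i) (m + 1) (by omega) (by omega))
    have d := dnN_seg hq i (m - i) m (by omega) (by omega)
    rw [cm] at u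
    rw [qm] at d
    exact IH _ (by omega) _ (by omega) _ _ u d
  have F3 : ∀ i, i + 2 ≤ m → R (q i) < L (c (i + 2)) := by
    intro i h1
    by_contra h
    push Not at h
    have u := (upN_seg hc 0 (i + 2) (i + 2) (by omega) (by omega))
    have d := (DnN.one h).trans (dnN_seg hq 0 i i (by omega) (by omega))
    rw [c0] at u
    rw [q0] at d
    exact IH _ (by omega) _ (by omega) _ _ u d
  have F4 : ∀ i, 2 ≤ i → i ≤ m → R (c (i - 1)) < L (q i) := by
    intro i h1 h2
    by_contra h
    push Not at h
    have u := (upN_seg hc (i - 1) (m + 2 - i) (m + 1) (by omega) (by omega))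
    have d := (dnN_seg hq i (m - i) m (by omega) (by omega)).trans (DnN.one h)
    rw [cm] at u
    rw [qm] at d
    exact IH _ (by omega) _ (by omega) _ _ u d
  have F5 : ∀ i j, i + 2 ≤ j → j ≤ m → R (q i) < L (q j) := by
    intro i j h1 h2
    by_contra h
    push Not at h
    have d := ((dnN_seg hq j (m - j) m (by omega) (by omega)).trans (DnN.one h)).trans
      (dnN_seg hq 0 i i (by omega) (by omega))
    rw [q0, qm] at d
    exact IH _ (by omega) _ (by omega) _ _ hu1 d
  have qc0 : q 0 = c 0 := by rw [q0, c0]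
  have qcm : q m = c (m + 1) := by rw [qm, cm]
  have F6 : ∀ i, i < m → L (q i) ≤ R (q (i + 1)) := by
    intro i hi
    rcases Nat.eq_zero_or_pos i with rfl | h0
    · have h1 := F2 1 (by omega) (by omega)
      have h2 := clt 0 2 (by omega) (by omega)
      rw [qc0]
      linarith [hle (c 0)]
    · rcases Nat.lt_or_ge (i + 1) m with h1 | h1
      · have h2 := F2 (i + 1) (by omega) (by omega)
        have h3 := F1 i (by omega) (by omega)
        have h4 := clt i (i + 1 + 1) (by omega) (by omega)
        linarith
      · obtain rfl : i + 1 = m := by omega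
        rw [qcm]
        have h3 := F1 i (by omega) (by omega)
        have h4 := clt i (i + 1 + 1) (by omega) (by omega)
        linarith [hle (c (i + 1 + 1))]
  have Fcc : ∀ i j, i < j → j ≤ m + 1 → c i ≠ c j ∧ ¬ Ov L R (c i) (c j) := by
    intro i j h1 h2
    have := clt i j h1 h2
    refine ⟨?_, ?_⟩
    · intro h
      rw [h] at this
      linarith [hle (c j)]
    · rintro ⟨h3, h4⟩
      linarith
  have Fqc : ∀ i j, i ≤ m → 1 ≤ j → j ≤ m → q i ≠ c j ∧
      (Ov L R (q i) (c j) ↔ 1 ≤ i ∧ i ≤ m - 1 ∧ (j = i ∨ j = i + 1)) := by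
    intro i j h1 h2 h3
    rcases Nat.eq_zero_or_pos i with rfl | h0
    · rw [qc0]
      refine ⟨(Fcc 0 j (by omega) (by omega)).1, ?_⟩
      have := (Fcc 0 j (by omega) (by omega)).2
      simp [this]
    rcases Nat.eq_or_lt_of_le h1 with rfl | h4
    · rw [qcm]
      refine ⟨(Fcc j (i + 1) (by omega) (by omega)).1.symm, ?_⟩
      have := (Fcc j (i + 1) (by omega) (by omega)).2
      rw [Ov.symm'] at this
      simp only [this, false_iff]
      omega
    have f1 := F1 i (by omega) (by omega)
    have f2 := F2 i (by omega) (by omega)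
    have f3 := clt i (i + 1) (by omega) (by omega)
    have f4 := hle (c i)
    have f5 := hle (c (i + 1))
    by_cases e1 : j = i
    · subst e1
      refine ⟨?_, ?_⟩
      · intro h
        rw [h] at f2
        linarith
      · refine iff_of_true ⟨f1, by linarith⟩ ?_
        omega
    by_cases e2 : j = i + 1
    · subst e2
      refine ⟨?_, ?_⟩
      · intro h
        rw [h] at f1
        linarith
      · refine iff_of_true ⟨by linarith, f2⟩ ?_
        omega
    have no : ¬ Ov L R (q i) (c j) := by
      rintro ⟨o1, o2⟩
      rcases Nat.lt_or_ge j i with h5 | h5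
      · have g1 := F4 i (by omega) (by omega)
        rcases Nat.lt_or_ge j (i - 1) with h6 | h6
        · have := clt j (i - 1) (by omega) (by omega)
          linarith [hle (c (i - 1))]
        · obtain rfl : j = i - 1 := by omega
          linarith
      · have g1 := F3 i (by omega)
        rcases Nat.lt_or_ge (i + 2) j with h6 | h6
        · have := clt (i + 2) j (by omega) (by omega)
          linarith [hle (c (i + 2))]
        · obtain rfl : j = i + 2 := by omega
          linarith
    refine ⟨?_, iff_of_false no (by omega)⟩
    intro h
    apply no
    rw [h]
    exact ⟨hle _, hle _⟩
  have Fqq : ∀ i j, i < j → j ≤ m → q i ≠ q j ∧ (Ov L R (q i) (q j) ↔ j = i + 1) := by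
    intro i j h1 h2
    by_cases e : j = i + 1
    · subst e
      refine ⟨?_, iff_of_true ⟨F6 i (by omega), hq i (by omega)⟩ rfl⟩
      intro h
      rcases Nat.eq_zero_or_pos i with rfl | h0
      · have := (Fqc 1 1 (by omega) (by omega) (by omega)).2.2 (by omega)
        rw [zero_add] at h
        rw [← h, qc0] at this
        exact (Fcc 0 1 (by omega) (by omega)).2 this
      · have := (Fqc i i (by omega) (by omega) (by omega)).2.2 (by omega)
        rw [h] at this
        have := (Fqc (i + 1) i (by omega) (by omega) (by omega)).2.1 this
        omega
    · have f := F5 i j (by omega) h2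
      refine ⟨?_, iff_of_false ?_ e⟩
      · intro h
        rw [h] at f
        linarith [hle (q j)]
      · rintro ⟨o1, o2⟩
        linarith
  obtain ⟨k, rfl⟩ : ∃ k, m = k + 2 := ⟨m - 2, by omega⟩
  have Fcc' : ∀ i j, i ≠ j → i ≤ k + 2 + 1 → j ≤ k + 2 + 1 → c i ≠ c j ∧ ¬ Ov L R (c i) (c j) := by
    intro i j h1 h2 h3
    rcases Nat.lt_or_gt_of_ne h1 with h | h
    · exact Fcc i j h h3
    · rw [Ov.symm', ne_comm]
      exact Fcc j i h h2
  have Fqq' : ∀ i j, i ≠ j → i ≤ k + 2 → j ≤ k + 2 → q i ≠ q j ∧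
      (Ov L R (q i) (q j) ↔ j = i + 1 ∨ i = j + 1) := by
    intro i j h1 h2 h3
    rcases Nat.lt_or_gt_of_ne h1 with h | h
    · rw [(Fqq i j h h3).2]
      exact ⟨(Fqq i j h h3).1, by omega⟩
    · rw [Ov.symm', (Fqq j i h h2).2]
      exact ⟨(Fqq j i h h2).1.symm, by omega⟩
  apply hG k
  refine induced_of hrep (Radj k) (fun v => match v with
    | Sum.inl x => q x
    | Sum.inr (Sum.inl i) => c (i + 2)
    | Sum.inr (Sum.inr j) => c (if j = 0 then 1 else k + 2)) ?_
  rintro (a | a | a) (b | b | b) hab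
  · simp only [ne_eq, Sum.inl.injEq, Fin.ext_iff] at hab
    simp only [Radj]
    have := Fqq' a b hab (by omega) (by omega)
    rw [this.2]
    exact ⟨this.1, by omega⟩
  · simp only [Radj, or_false, false_or]
    have := Fqc a (b + 2) (by omega) (by omega) (by omega)
    rw [this.2]
    exact ⟨this.1, by omega⟩
  · simp only [Radj, or_false, false_or]
    have this := Fqc a (if b = 0 then 1 else k + 2) (by omega) (by split_ifs <;> omega)
      (by split_ifs <;> omega)
    rw [this.2]
    refine ⟨this.1, ?_⟩
    split_ifs with hb
    · have hb' : (b : ℕ) = 0 := by rw [hb]; rfl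
      omega
    · have hb' : (b : ℕ) = 1 := by
        have : (b : ℕ) ≠ 0 := fun h => hb (Fin.ext h)
        omega
      omega
  · simp only [Radj, or_false, false_or]
    have := Fqc b (a + 2) (by omega) (by omega) (by omega)
    rw [Ov.symm', this.2]
    exact ⟨this.1.symm, by omega⟩
  · simp only [ne_eq, Sum.inr.injEq, Sum.inl.injEq, Fin.ext_iff] at hab
    simp only [Radj]
    have := Fcc' (a + 2) (b + 2) (by omega) (by omega) (by omega)
    exact ⟨this.1, by simp [this.2]⟩
  · simp only [Radj]
    have := Fcc' (a + 2) (if b = 0 then 1 else k + 2) (by split_ifs <;> omega) (by omega)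
      (by split_ifs <;> omega)
    exact ⟨this.1, by simp [this.2]⟩
  · simp only [Radj, or_false, false_or]
    have this := Fqc b (if a = 0 then 1 else k + 2) (by omega) (by split_ifs <;> omega)
      (by split_ifs <;> omega)
    rw [Ov.symm', this.2]
    refine ⟨this.1.symm, ?_⟩
    split_ifs with hb
    · have hb' : (a : ℕ) = 0 := by rw [hb]; rfl
      omega
    · have hb' : (a : ℕ) = 1 := by
        have : (a : ℕ) ≠ 0 := fun h => hb (Fin.ext h)
        omega
      omega
  · simp only [Radj]
    have := Fcc' (if a = 0 then 1 else k + 2) (b + 2) (by split_ifs <;> omega) 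
      (by split_ifs <;> omega) (by omega)
    exact ⟨this.1, by simp [this.2]⟩
  · have := Fcc' (if a = 0 then 1 else k + 2) (if b = 0 then 1 else k + 2) ?_
      (by split_ifs <;> omega) (by split_ifs <;> omega)
    · simp only [Radj]
      exact ⟨this.1, by simp [this.2]⟩
    · fin_cases a <;> fin_cases b <;> simp at hab ⊢

/-! ### Lemma Z -/

section
variable {V : Type*} {L R : V → ℝ}

theorem exists_q {i j n : ℕ} {a b x y : V} (hn : i + 1 + j = n) (h1 : DnN L R i b x)
    (hl : Loose L R x y) (h2 : DnN L R j y a) :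
    ∃ q : ℕ → V, q 0 = a ∧ q n = b ∧ q j = y ∧ q (j + 1) = x ∧
      ∀ m < n, L (q (m + 1)) ≤ R (q m) := by
  obtain ⟨f, f0, fi, hf⟩ := h1.exists_fun
  obtain ⟨g, g0, gj, hg⟩ := h2.exists_fun
  refine ⟨fun m => if m ≤ j then g m else f (m - (j + 1)), by simp [g0], ?_, by simp [gj],
    by simp [f0], ?_⟩
  · simp only
    rw [if_neg (by omega), ← fi]
    congr 1
    omega
  · intro m hm
    rcases Nat.lt_or_ge m j with h | h
    · simp only
      rw [if_pos (by omega), if_pos (by omega)]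
      exact hg m h
    · rcases Nat.eq_or_lt_of_le h with h | h
      · subst h
        simp only
        rw [if_neg (by omega), if_pos (by omega), Nat.sub_self, f0, gj]
        exact hl.dn
      · simp only
        rw [if_neg (by omega), if_neg (by omega)]
        have := hf (m - (j + 1)) (by omega)
        rwa [show m - (j + 1) + 1 = m + 1 - (j + 1) by omega] at this

/-- A closed walk consisting of an up chain `c` and a down chain `q`. -/
structure ZC (L R : V → ℝ) (n : ℕ) (c q : ℕ → V) : Prop where
  le : ∀ v, L v ≤ R v
  hR : ∀ m n, m < n → ∀ a b : V, UpN L R n a b → DnN L R m b a → False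
  hc : ∀ i < n, R (c i) < L (c (i + 1))
  hq : ∀ i < n, L (q (i + 1)) ≤ R (q i)
  q0 : q 0 = c 0
  qn : q n = c n

variable {n : ℕ} {c q : ℕ → V}

theorem ZC.clt (h : ZC L R n c q) (i j : ℕ) (hij : i < j) (hj : j ≤ n) : R (c i) < L (c j) :=
  up_lt h.le h.hc i j hij hj

theorem ZC.B1 (h : ZC L R n c q) (i : ℕ) (hi : i ≤ n) : L (q i) ≤ R (c i) := by
  by_contra h'
  push Not at h'
  have u := (upN_seg h.hc 0 i i (by omega) (by omega)).trans (UpN.one h')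
  have d := dnN_seg h.hq 0 i i (by omega) (by omega)
  rw [h.q0] at d
  exact h.hR _ _ (by omega) _ _ u d

theorem ZC.B2 (h : ZC L R n c q) (i : ℕ) (hi : i ≤ n) : L (c i) ≤ R (q i) := by
  by_contra h'
  push Not at h'
  have u := (UpN.one h').trans (upN_seg h.hc i (n - i) n (by omega) (by omega))
  have d := dnN_seg h.hq i (n - i) n (by omega) (by omega)
  rw [h.qn] at d
  exact h.hR _ _ (by omega) _ _ u d

theorem ZC.B3 (h : ZC L R n c q) (i j : ℕ) (hi : i + 2 ≤ j) (hj : j ≤ n) : R (q i) < L (q j) := by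
  by_contra h'
  push Not at h'
  have u := (upN_seg h.hc 0 n n (by omega) (by omega))
  have d := ((dnN_seg h.hq j (n - j) n (by omega) (by omega)).trans (DnN.one h')).trans
      (dnN_seg h.hq 0 i i (by omega) (by omega))
  rw [h.qn, h.q0] at d
  exact h.hR _ _ (by omega) _ _ u d

theorem ZC.B4 (h : ZC L R n c q) (i j : ℕ) (hi : i + 2 ≤ j) (hj : j ≤ n) : R (q i) < L (c j) := by
  by_contra h'
  push Not at h'
  have u := (upN_seg h.hc 0 j j (by omega) (by omega))
  have d := (DnN.one h').trans (dnN_seg h.hq 0 i i (by omega) (by omega))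
  rw [h.q0] at d
  exact h.hR _ _ (by omega) _ _ u d

theorem ZC.B4' (h : ZC L R n c q) (i j : ℕ) (hi : i + 2 ≤ j) (hj : j ≤ n) : R (c i) < L (q j) := by
  by_contra h'
  push Not at h'
  have u := (upN_seg h.hc i (n - i) n (by omega) (by omega))
  have d := (dnN_seg h.hq j (n - j) n (by omega) (by omega)).trans (DnN.one h')
  rw [h.qn] at d
  exact h.hR _ _ (by omega) _ _ u d

theorem ZC.B5 (h : ZC L R n c q) (i : ℕ) (hi : i < n) : L (q i) ≤ R (q (i + 1)) := by
  have h1 := h.B1 i (by omega)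
  have h2 := h.B2 (i + 1) (by omega)
  have h3 := h.hc i hi
  linarith

/-- The statement of Lemma Z for closed walks with `n` up steps. -/
def ZProp (L R : V → ℝ) (n : ℕ) : Prop :=
  ∀ (a b x y : V) (i j : ℕ), i + 1 + j = n → UpN L R n a b → DnN L R i b x → Loose L R x y →
    DnN L R j y a → False

theorem ZC.C1 (h : ZC L R n c q) (IH : ∀ n' < n, ZProp L R n') (d : ℕ) (hd : d + 1 ≤ n)
    (hl : Loose L R (q (d + 1)) (q d)) (j : ℕ) (h1 : 1 ≤ j) (h2 : j ≤ d) :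
    L (c (j + 1)) ≤ R (q j) := by
  by_contra h'
  push Not at h'
  have u := (UpN.one h').trans (upN_seg h.hc (j + 1) (n - j - 1) n (by omega) (by omega))
  have d1 := dnN_seg h.hq (d + 1) (n - d - 1) n (by omega) (by omega)
  have d2 := dnN_seg h.hq j (d - j) d (by omega) (by omega)
  rw [h.qn] at d1
  rw [show 1 + (n - j - 1) = n - j by omega] at u
  exact IH (n - j) (by omega) _ _ _ _ _ _ (by omega) u d1 hl d2

theorem ZC.C2 (h : ZC L R n c q) (IH : ∀ n' < n, ZProp L R n') (d : ℕ) (hd : d + 1 ≤ n)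
    (hl : Loose L R (q (d + 1)) (q d)) (j : ℕ) (h1 : 1 ≤ j) (h2 : j < d) :
    R (c j) < L (q (j + 1)) := by
  by_contra h'
  push Not at h'
  have u := (upN_seg h.hc j (n - j) n (by omega) (by omega))
  have d1 := dnN_seg h.hq (d + 1) (n - d - 1) n (by omega) (by omega)
  have d2 := (dnN_seg h.hq (j + 1) (d - j - 1) d (by omega) (by omega)).trans (DnN.one h')
  rw [h.qn] at d1
  exact IH (n - j) (by omega) _ _ _ _ _ _ (by omega) u d1 hl d2

theorem ZC.D1 (h : ZC L R n c q) (IH : ∀ n' < n, ZProp L R n') (d : ℕ) (hd : d + 1 ≤ n)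
    (hl : Loose L R (q (d + 1)) (q d)) (j : ℕ) (h1 : d ≤ j) (h2 : j + 2 ≤ n) :
    L (q (j + 1)) ≤ R (c j) := by
  by_contra h'
  push Not at h'
  have u := (upN_seg h.hc 0 j j (by omega) (by omega)).trans (UpN.one h')
  have d1 := dnN_seg h.hq (d + 1) (j - d) (j + 1) (by omega) (by omega)
  have d2 := dnN_seg h.hq 0 d d (by omega) (by omega)
  rw [h.q0] at d2
  exact IH (j + 1) (by omega) _ _ _ _ _ _ (by omega) u d1 hl d2

theorem ZC.D2 (h : ZC L R n c q) (IH : ∀ n' < n, ZProp L R n') (d : ℕ) (hd : d + 1 ≤ n)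
    (hl : Loose L R (q (d + 1)) (q d)) (j : ℕ) (h1 : d < j) (h2 : j + 2 ≤ n) :
    R (q j) < L (c (j + 1)) := by
  by_contra h'
  push Not at h'
  have u := (upN_seg h.hc 0 (j + 1) (j + 1) (by omega) (by omega))
  have d1 := (DnN.one h').trans (dnN_seg h.hq (d + 1) (j - d - 1) j (by omega) (by omega))
  have d2 := dnN_seg h.hq 0 d d (by omega) (by omega)
  rw [h.q0] at d2
  exact IH (j + 1) (by omega) _ _ _ _ _ _ (by omega) u d1 hl d2

theorem ne_of_not_ov (hle : ∀ v, L v ≤ R v) {u v : V} (h : ¬ Ov L R u v) : u ≠ v := by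
  rintro rfl
  exact h ⟨hle _, hle _⟩

theorem ZC.Fcc (h : ZC L R n c q) (i j : ℕ) (hij : i ≠ j) (hi : i ≤ n) (hj : j ≤ n) :
    ¬ Ov L R (c i) (c j) := by
  rintro ⟨h1, h2⟩
  rcases Nat.lt_or_gt_of_ne hij with h3 | h3
  · linarith [h.clt i j h3 hj]
  · linarith [h.clt j i h3 hi]

theorem ZC.Fcc' (h : ZC L R n c q) (i j : ℕ) (hij : i ≠ j) (hi : i ≤ n) (hj : j ≤ n) (P : Prop)
    (hP : ¬ P) : c i ≠ c j ∧ (P ↔ Ov L R (c i) (c j)) :=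
  ⟨ne_of_not_ov h.le (h.Fcc i j hij hi hj), iff_of_false hP (h.Fcc i j hij hi hj)⟩

theorem ZC.Fqq' (h : ZC L R n c q) (i j : ℕ) (hij : i ≠ j) (hi : 1 ≤ i) (hj : 1 ≤ j)
    (hi' : i ≤ n) (hj' : j ≤ n) (P : Prop)
    (hP : P ↔ (j = i + 1 ∨ i = j + 1)) : q i ≠ q j ∧ (P ↔ Ov L R (q i) (q j)) := by
  have key : ∀ i j, i < j → 1 ≤ i → j ≤ n → q i ≠ q j ∧ (Ov L R (q i) (q j) ↔ j = i + 1) := by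
    intro i j h1 h2 h3
    by_cases e : j = i + 1
    · subst e
      refine ⟨?_, iff_of_true ⟨h.B5 i (by omega), h.hq i (by omega)⟩ rfl⟩
      intro h'
      have g1 := h.B3 (i - 1) (i + 1) (by omega) h3
      have g2 := h.hq (i - 1) (by omega)
      rw [show i - 1 + 1 = i by omega, h'] at g2
      linarith
    · have g := h.B3 i j (by omega) h3
      have no : ¬ Ov L R (q i) (q j) := fun o => by linarith [o.1, o.2]
      exact ⟨ne_of_not_ov h.le no, iff_of_false no e⟩
  rw [hP]
  rcases Nat.lt_or_gt_of_ne hij with h1 | h1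
  · have := key i j h1 hi hj'
    rw [this.2]
    exact ⟨this.1, by omega⟩
  · have := key j i h1 hj hi'
    rw [Ov.symm', this.2]
    exact ⟨this.1.symm, by omega⟩

/-- Overlap structure between `q` and `c` given a loose step at `d`. -/
theorem ZC.Fqc' (h : ZC L R n c q) (IH : ∀ n' < n, ZProp L R n') (d : ℕ) (hd : 1 ≤ d)
    (hd' : d + 1 ≤ n) (hl : Loose L R (q (d + 1)) (q d)) (i j : ℕ) (hi : 1 ≤ i) (hi' : i + 1 ≤ n)
    (hj : j ≤ n) (P : Prop)
    (hP : P ↔ (i ≤ d ∧ (j = i ∨ j = i + 1 ∨ (i = 1 ∧ j = 0))) ∨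
      (d < i ∧ (j = i ∨ j + 1 = i ∨ (i + 1 = n ∧ j = n)))) :
    q i ≠ c j ∧ (P ↔ Ov L R (q i) (c j)) := by
  have b1 := h.B1 i (by omega)
  have b2 := h.B2 i (by omega)
  have oii : Ov L R (q i) (c i) := ⟨b1, b2⟩
  have hle := h.le
  have key : Ov L R (q i) (c j) ↔ (i ≤ d ∧ (j = i ∨ j = i + 1 ∨ (i = 1 ∧ j = 0))) ∨
      (d < i ∧ (j = i ∨ j + 1 = i ∨ (i + 1 = n ∧ j = n))) := by
    by_cases e0 : j = i
    · subst e0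
      exact iff_of_true oii (by omega)
    by_cases e1 : i + 2 ≤ j
    · have := h.B4 i j e1 hj
      exact iff_of_false (fun o => by linarith [o.1, o.2]) (by omega)
    by_cases e2 : j + 2 ≤ i
    · have := h.B4' j i e2 (by omega)
      exact iff_of_false (fun o => by linarith [o.1, o.2]) (by omega)
    by_cases e3 : j = i + 1
    · subst e3
      have c1 := h.hc i (by omega)
      by_cases e4 : i ≤ d
      · have := h.C1 IH d hd' hl i hi e4
        exact iff_of_true ⟨by linarith [hle (c (i + 1))], this⟩ (by omega)
      · by_cases e5 : i + 1 = n
        · refine iff_of_true ⟨by linarith [hle (c (i + 1))], ?_⟩ (by omega)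
          have := h.hq i (by omega)
          rw [e5, h.qn] at this
          rw [e5]
          exact this
        · have := h.D2 IH d hd' hl i (by omega) (by omega)
          exact iff_of_false (fun o => by linarith [o.1, o.2]) (by omega)
    · obtain ⟨i', rfl⟩ : ∃ i', i = i' + 1 := ⟨i - 1, by omega⟩
      obtain rfl : j = i' := by omega
      have c1 := h.hc j (by omega)
      by_cases e4 : j + 1 ≤ d
      · by_cases e5 : j = 0
        · subst e5
          refine iff_of_true ⟨?_, by linarith [hle (c 0)]⟩ (by omega)
          rw [← h.q0]
          exact h.hq 0 (by omega)
        · have := h.C2 IH d hd' hl j (by omega) (by omega)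
          exact iff_of_false (fun o => by linarith [o.1, o.2]) (by omega)
      · have := h.D1 IH d hd' hl j (by omega) (by omega)
        exact iff_of_true ⟨this, by linarith [hle (c j)]⟩ (by omega)
  refine ⟨?_, by rw [hP, key]⟩
  intro e
  have f1 : j = i := by
    by_contra hne
    rw [e] at oii
    exact h.Fcc j i hne hj (by omega) oii
  rw [f1] at e
  by_cases e4 : i ≤ d
  · have g1 := h.C1 IH d hd' hl i hi e4
    rw [e] at g1
    linarith [h.hc i (by omega)]
  · have g1 := h.D1 IH d hd' hl (i - 1) (by omega) (by omega)
    rw [show i - 1 + 1 = i by omega, e] at g1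
    linarith [h.clt (i - 1) i (by omega) (by omega)]

end

section
variable {k : ℕ}

theorem inl_eq_special1 (m : Fin (k + 1)) :
    (Sum.inl m : QVert k) = Qspecial1 k ↔ (m : ℕ) = k := by
  simp [Qspecial1, Fin.ext_iff]

theorem inr_eq_special1 (a : Fin k ⊕ Fin 2) :
    (Sum.inr a : QVert k) = Qspecial1 k ↔ False := by
  simp [Qspecial1]

theorem inl_eq_special2 (m : Fin (k + 1)) :
    (Sum.inl m : QVert k) = Qspecial2 k ↔ False := by
  unfold Qspecial2
  split_ifs <;> simp

theorem inrl_eq_special2 (m : Fin k) :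
    (Sum.inr (Sum.inl m) : QVert k) = Qspecial2 k ↔ (m : ℕ) + 1 = k := by
  unfold Qspecial2
  split_ifs with h
  · subst h
    exact m.elim0
  · simp [Fin.ext_iff]
    omega

theorem inrr_eq_special2 (m : Fin 2) :
    (Sum.inr (Sum.inr m) : QVert k) = Qspecial2 k ↔ k = 0 ∧ (m : ℕ) = 1 := by
  unfold Qspecial2
  split_ifs with h
  · simp [Fin.ext_iff, h]
  · simp [h]

end

/-- The swap isomorphism between `T_{i,j}` and `T_{j,i}`. -/
theorem Tgraph_swap {V : Type*} {G : SimpleGraph V} {i j : ℕ}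
    (h : HasInducedSubgraph G (Tgraph i j)) : HasInducedSubgraph G (Tgraph j i) := by
  obtain ⟨f, hf⟩ := h
  refine ⟨(Equiv.sumComm _ _).toEmbedding.trans f, ?_⟩
  intro a b
  simp only [Function.Embedding.trans_apply, Equiv.coe_toEmbedding, Equiv.sumComm_apply]
  rw [← hf]
  unfold Tgraph
  rw [SimpleGraph.fromRel_adj, SimpleGraph.fromRel_adj]
  rcases a with a | a <;> rcases b with b | b <;>
    simp only [Tadj, Sum.swap_inl, Sum.swap_inr, ne_eq, Sum.inl.injEq, Sum.inr.injEq,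
      reduceCtorEq, or_false, false_or, not_false_eq_true, true_and] <;> tauto

/-- Interior defect gives a graph `T_{i,j}`. -/
theorem interior_T {V : Type*} {G : SimpleGraph V} {L R : V → ℝ} (hrep : CRep G L R)
    {c q : ℕ → V} (i j : ℕ) (h : ZC L R (i + j + 3) c q)
    (IH : ∀ n' < i + j + 3, ZProp L R n') (hl : Loose L R (q (i + 1 + 1)) (q (i + 1))) :
    HasInducedSubgraph G (Tgraph i j) := by
  have QC := h.Fqc' IH (i + 1) (by omega) (by omega) hl
  have CQ : ∀ (a b : ℕ), 1 ≤ a → a + 1 ≤ i + j + 3 → b ≤ i + j + 3 → ∀ (P : Prop),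
    (P ↔ (a ≤ i + 1 ∧ (b = a ∨ b = a + 1 ∨ (a = 1 ∧ b = 0))) ∨
      (i + 1 < a ∧ (b = a ∨ b + 1 = a ∨ (a + 1 = i + j + 3 ∧ b = i + j + 3)))) →
    c b ≠ q a ∧ (P ↔ Ov L R (c b) (q a)) := by
    intro a b h1 h2 h3 P hP
    have := QC a b h1 h2 h3 P hP
    rw [Ov.symm']
    exact ⟨this.1.symm, this.2⟩
  have QQ := h.Fqq'
  have CC := h.Fcc'
  refine induced_of hrep (Tadj i j) (fun v => match v with
    | Sum.inl (Sum.inl m) => q (m + 1)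
    | Sum.inl (Sum.inr (Sum.inl a)) => c (a + 2)
    | Sum.inl (Sum.inr (Sum.inr b)) => c b
    | Sum.inr (Sum.inl m) => q (i + j + 2 - m)
    | Sum.inr (Sum.inr (Sum.inl a)) => c (i + j + 1 - a)
    | Sum.inr (Sum.inr (Sum.inr b)) => c (i + j + 3 - b)) ?_
  rintro ((a | a | a) | (a | a | a)) ((b | b | b) | (b | b | b)) hab <;>
    simp only [Tadj, Qadj, inl_eq_special1, inr_eq_special1, inl_eq_special2, inrl_eq_special2,
      inrr_eq_special2, ne_eq, Sum.inl.injEq, Sum.inr.injEq, reduceCtorEq, Fin.ext_iff,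
      or_false, false_or, false_and, and_false] at hab ⊢ <;>
    first
    | (apply QQ <;> omega)
    | (apply QC <;> omega)
    | (apply CQ <;> omega)
    | (apply CC <;> first | omega | exact id)

theorem inl_eq_Sextra {k : ℕ} (m : Fin (k + 1)) :
    (Sum.inl m : QVert k) = Sextra k ↔ False := by
  unfold Sextra
  split_ifs <;> simp

theorem inrl_eq_Sextra {k : ℕ} (m : Fin k) :
    (Sum.inr (Sum.inl m) : QVert k) = Sextra k ↔ (m : ℕ) + 2 = k := by
  unfold Sextra
  split_ifs with h
  · simp
    omega
  · simp [Fin.ext_iff]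
    omega

theorem inrr_eq_Sextra {k : ℕ} (m : Fin 2) :
    (Sum.inr (Sum.inr m) : QVert k) = Sextra k ↔ k ≤ 1 ∧ (m : ℕ) = 0 := by
  unfold Sextra
  split_ifs with h
  · simp only [Sum.inr.injEq, h, true_and, Fin.ext_iff]
    rfl
  · simp [h]

/-- Defect at the end. -/
theorem end_defect {V : Type*} {G : SimpleGraph V} {L R : V → ℝ} (hrep : CRep G L R)
    (hG1 : ¬ HasInducedSubgraph G G1)
    (hS : ∀ i : ℕ, 1 ≤ i → ¬ HasInducedSubgraph G (Sgraph i))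
    (hS'' : ∀ i : ℕ, 2 ≤ i → ¬ HasInducedSubgraph G (S''graph i))
    (hT : ∀ i j : ℕ, ¬ HasInducedSubgraph G (Tgraph i j))
    {c q : ℕ → V} (k : ℕ) (hk : 1 ≤ k) (h : ZC L R (k + 1) c q)
    (IH : ∀ n' < k + 1, ZProp L R n') (hl : Loose L R (q (k + 1)) (q k)) : False := by
  have hle := h.le
  have QC := h.Fqc' IH k (by omega) (by omega) hl
  have CQ : ∀ (a b : ℕ), 1 ≤ a → a + 1 ≤ k + 1 → b ≤ k + 1 → ∀ (P : Prop),
    (P ↔ (a ≤ k ∧ (b = a ∨ b = a + 1 ∨ (a = 1 ∧ b = 0))) ∨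
      (k < a ∧ (b = a ∨ b + 1 = a ∨ (a + 1 = k + 1 ∧ b = k + 1)))) →
    c b ≠ q a ∧ (P ↔ Ov L R (c b) (q a)) := by
    intro a b h1 h2 h3 P hP
    have := QC a b h1 h2 h3 P hP
    rw [Ov.symm']
    exact ⟨this.1.symm, this.2⟩
  have QQ := h.Fqq'
  have CC := h.Fcc'
  have hl' := hl
  obtain ⟨s, t, st, h1, h2⟩ := hl
  rw [h.qn] at h1
  have E1 : L s ≤ R (c k) := by
    by_contra h'
    push Not at h'
    have u := ((upN_seg h.hc 0 k k (by omega) (by omega)).trans (UpN.one h')).trans (UpN.one st)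
    have d := (DnN.one h2).trans (dnN_seg h.hq 0 k k (by omega) (by omega))
    rw [h.q0] at d
    exact h.hR _ _ (by omega) _ _ u d
  have E2 : L t ≤ R (c (k + 1)) := by
    by_contra h'
    push Not at h'
    have u := (upN_seg h.hc 0 (k + 1) (k + 1) (by omega) (by omega)).trans (UpN.one h')
    have d := (DnN.one h2).trans (dnN_seg h.hq 0 k k (by omega) (by omega))
    rw [h.q0] at d
    exact h.hR _ _ (by omega) _ _ u d
  have ck := h.hc k (by omega)
  have E3 : ∀ j, j ≤ k → R (c j) < L t := by
    intro j hj
    have := h.clt j (k + 1) (by omega) (by omega)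
    linarith
  have E4 : ∀ i, i + 1 ≤ k → R (q i) < L t := by
    intro i hi
    by_contra h'
    push Not at h'
    have u := (upN_seg h.hc 0 k k (by omega) (by omega)).trans (UpN.one (E3 k le_rfl))
    have d := (DnN.one h').trans (dnN_seg h.hq 0 i i (by omega) (by omega))
    rw [h.q0] at d
    exact h.hR _ _ (by omega) _ _ u d
  have E5 : ∀ i, i + 2 ≤ k → R (q i) < L s := by
    intro i hi
    by_contra h'
    push Not at h'
    have u := (upN_seg h.hc 0 (k + 1) (k + 1) (by omega) (by omega))
    have d := ((DnN.one h1).trans (DnN.one h')).trans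
      (dnN_seg h.hq 0 i i (by omega) (by omega))
    rw [h.q0] at d
    exact h.hR _ _ (by omega) _ _ u d
  have hs := hle s
  have ht := hle t
  have b1 := h.B1 k (by omega)
  have osk : Ov L R s (c k) := ⟨E1, by linarith [hle (c k)]⟩
  have osk1 : Ov L R s (c (k + 1)) := ⟨by linarith [hle (c (k + 1))], h1⟩
  have osq : Ov L R s (q k) := ⟨by linarith, by linarith⟩
  have otk1 : Ov L R t (c (k + 1)) := ⟨E2, by linarith⟩
  have otq : Ov L R t (q k) := ⟨h2, by linarith⟩
  have nst : ¬ Ov L R s t := fun o => by linarith [o.1, o.2]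
  have ntc : ∀ j, j ≤ k → ¬ Ov L R t (c j) := fun j hj o => by linarith [o.1, o.2, E3 j hj]
  have ntq : ∀ j, j + 1 ≤ k → ¬ Ov L R t (q j) := fun j hj o => by linarith [o.1, o.2, E4 j hj]
  have nsq : ∀ j, j + 2 ≤ k → ¬ Ov L R s (q j) := fun j hj o => by linarith [o.1, o.2, E5 j hj]
  have ST : ∀ P : Prop, ¬ P → s ≠ t ∧ (P ↔ Ov L R s t) := fun P hP =>
    ⟨ne_of_not_ov hle nst, iff_of_false hP nst⟩
  have TS : ∀ P : Prop, ¬ P → t ≠ s ∧ (P ↔ Ov L R t s) := fun P hP => by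
    rw [Ov.symm']
    exact ⟨(ST P hP).1.symm, (ST P hP).2⟩
  have TC : ∀ b, b ≤ k + 1 → ∀ P : Prop, (P ↔ b = k + 1) → t ≠ c b ∧ (P ↔ Ov L R t (c b)) := by
    intro b hb P hP
    rw [hP]
    by_cases e : b = k + 1
    · subst e
      refine ⟨?_, iff_of_true rfl otk1⟩
      intro e
      rw [e] at nst
      exact nst osk1
    · have := ntc b (by omega)
      exact ⟨ne_of_not_ov hle this, iff_of_false e this⟩
  have TQ : ∀ a, a ≤ k → ∀ P : Prop, (P ↔ a = k) → t ≠ q a ∧ (P ↔ Ov L R t (q a)) := by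
    intro b hb P hP
    rw [hP]
    by_cases e : b = k
    · subst e
      refine ⟨?_, iff_of_true rfl otq⟩
      intro e
      rw [e] at nst
      exact nst osq
    · have := ntq b (by omega)
      exact ⟨ne_of_not_ov hle this, iff_of_false e this⟩
  by_cases hsc : L s ≤ R (c (k - 1))
  · rcases Nat.lt_or_ge k 2 with hk2 | hk2
    · obtain rfl : k = 1 := by omega
      simp only [Nat.sub_self] at hsc
      have l02 := h.clt 0 2 (by omega) (by omega)
      have os0 : Ov L R s (c 0) := ⟨hsc, by linarith [hle (c 0)]⟩
      have SC : ∀ j, j ≤ 2 → s ≠ c j ∧ Ov L R s (c j) := by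
        intro j hj
        have oj : Ov L R s (c j) := by interval_cases j <;> assumption
        refine ⟨?_, oj⟩
        intro e
        rcases Nat.eq_zero_or_pos j with h0 | h0
        · have := h.Fcc j 1 (by omega) (by omega) (by omega)
          rw [← e] at this
          exact this osk
        · have := h.Fcc j 0 (by omega) (by omega) (by omega)
          rw [← e] at this
          exact this os0
      have SQ : s ≠ q 1 := by
        intro e
        rw [← e, Ov.symm'] at otq
        exact nst otq
      apply hG1
      refine induced_of hrep _ (fun v : Fin 6 => ![q 1, s, c 2, c 1, c 0, t] v) ?_
      have key : ∀ a b : Fin 6, a < b → (![q 1, s, c 2, c 1, c 0, t] a ≠ ![q 1, s, c 2, c 1, c 0, t] b ∧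
        ((fun u v : Fin 6 =>
          (u = 0 ∧ v = 1) ∨ ((u = 0 ∨ u = 1) ∧ (v = 2 ∨ v = 3 ∨ v = 4)) ∨
            (u = 5 ∧ (v = 0 ∨ v = 2))) a b ∨ (fun u v : Fin 6 =>
          (u = 0 ∧ v = 1) ∨ ((u = 0 ∨ u = 1) ∧ (v = 2 ∨ v = 3 ∨ v = 4)) ∨
            (u = 5 ∧ (v = 0 ∨ v = 2))) b a ↔
          Ov L R (![q 1, s, c 2, c 1, c 0, t] a) (![q 1, s, c 2, c 1, c 0, t] b))) := by
        have SC' : ∀ j, j ≤ 2 → ∀ P : Prop, P → s ≠ c j ∧ (P ↔ Ov L R s (c j)) :=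
          fun j hj P hP => ⟨(SC j hj).1, iff_of_true hP (SC j hj).2⟩
        have CT : ∀ b, b ≤ 2 → ∀ P : Prop, (P ↔ b = 2) → c b ≠ t ∧ (P ↔ Ov L R (c b) t) := by
          intro b hb P hP
          have := TC b hb P hP
          rw [Ov.symm']
          exact ⟨this.1.symm, this.2⟩
        intro a b hab
        fin_cases a <;> fin_cases b <;> first | (exfalso; revert hab; decide) | skip
        · exact ⟨SQ.symm, iff_of_true (by decide) (Ov.symm'.1 osq)⟩
        · exact QC 1 2 (by omega) (by omega) (by omega) _ (by decide)
        · exact QC 1 1 (by omega) (by omega) (by omega) _ (by decide)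
        · exact QC 1 0 (by omega) (by omega) (by omega) _ (by decide)
        · have := TQ 1 le_rfl True (by decide)
          exact ⟨this.1.symm, iff_of_true (by decide) (Ov.symm'.1 otq)⟩
        · exact SC' 2 (by omega) _ (by decide)
        · exact SC' 1 (by omega) _ (by decide)
        · exact SC' 0 (by omega) _ (by decide)
        · exact ST _ (by decide)
        · exact CC 2 1 (by omega) (by omega) (by omega) _ (by decide)
        · exact CC 2 0 (by omega) (by omega) (by omega) _ (by decide)
        · exact CT 2 (by omega) _ (by decide)
        · exact CC 1 0 (by omega) (by omega) (by omega) _ (by decide)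
        · exact CT 1 (by omega) _ (by decide)
        · exact CT 0 (by omega) _ (by decide)
      intro a b hab
      rcases lt_or_gt_of_ne hab with h' | h'
      · exact key a b h'
      · have := key b a h'
        rw [Ov.symm', or_comm]
        exact ⟨this.1.symm, this.2⟩
    · obtain ⟨i, rfl⟩ : ∃ i, k = i + 2 := ⟨k - 2, by omega⟩
      have c1 := h.C1 IH (i + 2) (by omega) hl' (i + 1) (by omega) (by omega)
      have c2 := h.hc (i + 1) (by omega)
      rw [show i + 2 - 1 = i + 1 by omega] at hsc
      refine hT i 0 (interior_T (c := c) (q := fun m => if m = i + 2 then s else q m) hrep i 0 ?_ IH ?_)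
      · refine ⟨h.le, h.hR, h.hc, ?_, by simpa using h.q0, by simpa using h.qn⟩
        intro m hm
        split_ifs with g1 g2 g2
        · omega
        · obtain rfl : m = i + 1 := by omega
          linarith
        · subst g2
          have := h.qn
          rw [this]
          exact h1
        · exact h.hq m hm
      · have e1 : (if i + 1 + 1 = i + 2 then s else q (i + 1 + 1)) = s := if_pos rfl
        have e2 : (if i + 1 = i + 2 then s else q (i + 1)) = q (i + 1) := if_neg (by omega)
        simp only [e1, e2]
        exact ⟨c (i + 1), c (i + 1 + 1), c2, hsc, c1⟩
  · push Not at hsc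
    have nsc : ∀ j, j + 1 ≤ k → ¬ Ov L R s (c j) := fun j hj o => by
      rcases Nat.eq_or_lt_of_le hj with e | e
      · obtain rfl : j = k - 1 := by omega
        linarith [o.1]
      · linarith [o.1, h.clt j (k - 1) (by omega) (by omega), hle (c (k - 1))]
    have SC : ∀ b, b ≤ k + 1 → ∀ P : Prop, (P ↔ b = k ∨ b = k + 1) →
        s ≠ c b ∧ (P ↔ Ov L R s (c b)) := by
      intro b hb P hP
      rw [hP]
      by_cases e : b = k ∨ b = k + 1
      · have no := h.Fcc k (k + 1) (by omega) (by omega) (by omega)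
        rcases e with rfl | rfl
        · refine ⟨?_, iff_of_true (by omega) osk⟩
          intro e
          rw [← e] at no
          exact no osk1
        · refine ⟨?_, iff_of_true (by omega) osk1⟩
          intro e
          rw [← e, Ov.symm'] at no
          exact no osk
      · have := nsc b (by omega)
        exact ⟨ne_of_not_ov hle this, iff_of_false e this⟩
    have SQ : ∀ a, a ≤ k → ∀ P : Prop, (P ↔ a = k ∨ (a + 1 = k ∧ L s ≤ R (q (k - 1)))) →
        s ≠ q a ∧ (P ↔ Ov L R s (q a)) := by
      intro a ha P hP
      rw [hP]
      rcases Nat.eq_or_lt_of_le ha with e | e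
      · subst e
        refine ⟨?_, iff_of_true (by omega) osq⟩
        intro e
        rw [← e, Ov.symm'] at otq
        exact nst otq
      rcases Nat.eq_or_lt_of_le e with e | e
      · obtain rfl : k = a + 1 := by omega
        simp only [Nat.add_sub_cancel] at hsc ⊢
        refine ⟨?_, ?_⟩
        · intro e
          have := h.B4 a (a + 2) (by omega) (by omega)
          rw [← e] at this
          linarith
        · have hb := h.B1 a (by omega)
          constructor
          · intro h'
            exact ⟨by rcases h' with h' | h'; omega; exact h'.2, by linarith⟩
          · intro h'
            exact Or.inr ⟨by trivial, h'.1⟩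
      · have := nsq a (by omega)
        refine ⟨ne_of_not_ov hle this, iff_of_false ?_ this⟩
        omega
    have QT : ∀ a, a ≤ k → ∀ P : Prop, (P ↔ a = k) → q a ≠ t ∧ (P ↔ Ov L R (q a) t) :=
      fun a h1 P h2 => ⟨(TQ a h1 P h2).1.symm, (iff_congr Iff.rfl Ov.symm').1 <| (TQ a h1 P h2).2⟩
    have CT : ∀ b, b ≤ k + 1 → ∀ P : Prop, (P ↔ b = k + 1) → c b ≠ t ∧ (P ↔ Ov L R (c b) t) :=
      fun a h1 P h2 => ⟨(TC a h1 P h2).1.symm, (iff_congr Iff.rfl Ov.symm').1 <| (TC a h1 P h2).2⟩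
    have CS : ∀ b, b ≤ k + 1 → ∀ P : Prop, (P ↔ b = k ∨ b = k + 1) →
        c b ≠ s ∧ (P ↔ Ov L R (c b) s) :=
      fun a h1 P h2 => ⟨(SC a h1 P h2).1.symm, (iff_congr Iff.rfl Ov.symm').1 <| (SC a h1 P h2).2⟩
    by_cases hq' : L s ≤ R (q (k - 1))
    · have k2 : 2 ≤ k := by
        by_contra h'
        obtain rfl : k = 1 := by omega
        simp only [Nat.sub_self] at hq' hsc
        rw [h.q0] at hq'
        linarith
      simp only [hq', and_true] at SQ
      have QS : ∀ b, b ≤ k → ∀ P : Prop, (P ↔ b = k ∨ b + 1 = k) →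
          q b ≠ s ∧ (P ↔ Ov L R (q b) s) :=
        fun a h1 P h2 => ⟨(SQ a h1 P h2).1.symm, (iff_congr Iff.rfl Ov.symm').1 <| (SQ a h1 P h2).2⟩
      apply hS'' k k2
      refine induced_of hrep (S''adj k) (fun v => match v with
        | Sum.inl (Sum.inl m) => if (m : ℕ) = k then t else q (m + 1)
        | Sum.inl (Sum.inr (Sum.inl a)) => c (a + 2)
        | Sum.inl (Sum.inr (Sum.inr b)) => c (1 - b)
        | Sum.inr _ => s) ?_
      rintro ((a | a | a) | a) ((b | b | b) | b) hab <;>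
        simp only [S''adj, Qadj, inl_eq_special1, inr_eq_special1, inl_eq_special2, inrl_eq_special2,
          inrr_eq_special2, inl_eq_Sextra, inrl_eq_Sextra, inrr_eq_Sextra,
          ne_eq, Sum.inl.injEq, Sum.inr.injEq, reduceCtorEq, Fin.ext_iff,
          or_false, false_or, false_and, and_false, not_true_eq_false] at hab ⊢ <;>
        (try split_ifs) <;>
        first
        | (exfalso; omega)
        | (apply QQ <;> omega)
        | (apply QC <;> omega)
        | (apply CQ <;> omega)
        | (apply TC <;> omega)
        | (apply CT <;> omega)
        | (apply TQ <;> omega)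
        | (apply QT <;> omega)
        | (apply SC <;> omega)
        | (apply CS <;> omega)
        | (apply SQ <;> omega)
        | (apply QS <;> omega)
        | (apply ST <;> first | omega | exact id)
        | (apply TS <;> first | omega | exact id)
        | (apply CC <;> first | omega | exact id)
    · simp only [hq', and_false, or_false] at SQ
      have QS : ∀ b, b ≤ k → ∀ P : Prop, (P ↔ b = k) →
          q b ≠ s ∧ (P ↔ Ov L R (q b) s) :=
        fun a h1 P h2 => ⟨(SQ a h1 P h2).1.symm, (iff_congr Iff.rfl Ov.symm').1 <| (SQ a h1 P h2).2⟩
      apply hS k hk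
      refine induced_of hrep (Sadj k) (fun v => match v with
        | Sum.inl (Sum.inl m) => if (m : ℕ) = k then t else q (m + 1)
        | Sum.inl (Sum.inr (Sum.inl a)) => c (a + 2)
        | Sum.inl (Sum.inr (Sum.inr b)) => c (1 - b)
        | Sum.inr _ => s) ?_
      rintro ((a | a | a) | a) ((b | b | b) | b) hab <;>
        simp only [Sadj, Qadj, inl_eq_special1, inr_eq_special1, inl_eq_special2, inrl_eq_special2,
          inrr_eq_special2, inl_eq_Sextra, inrl_eq_Sextra, inrr_eq_Sextra,
          ne_eq, Sum.inl.injEq, Sum.inr.injEq, reduceCtorEq, Fin.ext_iff,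
          or_false, false_or, false_and, and_false, not_true_eq_false] at hab ⊢ <;>
        (try split_ifs) <;>
        first
        | (exfalso; omega)
        | (apply QQ <;> omega)
        | (apply QC <;> omega)
        | (apply CQ <;> omega)
        | (apply TC <;> omega)
        | (apply CT <;> omega)
        | (apply TQ <;> omega)
        | (apply QT <;> omega)
        | (apply SC <;> omega)
        | (apply CS <;> omega)
        | (apply SQ <;> omega)
        | (apply QS <;> omega)
        | (apply ST <;> first | omega | exact id)
        | (apply TS <;> first | omega | exact id)
        | (apply CC <;> first | omega | exact id)

theorem CRep.reflect {V : Type*} {G : SimpleGraph V} {L R : V → ℝ} (h : CRep G L R) :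
    CRep G (fun v => - R v) (fun v => - L v) := by
  refine ⟨fun v => neg_le_neg (h.le v), ?_⟩
  intro u v huv
  rw [h.adj u v huv]
  simp only [neg_le_neg_iff]
  tauto

theorem lemmaZ {V : Type*} {G : SimpleGraph V}
    (hG1 : ¬ HasInducedSubgraph G G1)
    (hR : ∀ i : ℕ, ¬ HasInducedSubgraph G (Rgraph i))
    (hS : ∀ i : ℕ, 1 ≤ i → ¬ HasInducedSubgraph G (Sgraph i))
    (hS'' : ∀ i : ℕ, 2 ≤ i → ¬ HasInducedSubgraph G (S''graph i))
    (hT : ∀ i j : ℕ, ¬ HasInducedSubgraph G (Tgraph i j)) (n : ℕ) :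
    ∀ {L R : V → ℝ}, CRep G L R → ZProp L R n := by
  induction n using Nat.strong_induction_on with
  | _ n IH =>
  intro L R hrep a b x y i j hn hu h1 hl h2
  have IH' : ∀ n' < n, ZProp L R n' := fun n' hn' => IH n' hn' hrep
  obtain ⟨c, c0, cn, hc⟩ := hu.exists_fun
  obtain ⟨q, q0, qn, qj, qj1, hq⟩ := exists_q hn h1 hl h2
  have hl' : Loose L R (q (j + 1)) (q j) := by rw [qj, qj1]; exact hl
  have h : ZC L R n c q := ⟨hrep.le, fun m n hmn a b => lemmaR hR hrep m n hmn a b, hc, hq,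
    by rw [q0, c0], by rw [qn, cn]⟩
  rcases Nat.eq_zero_or_pos i with hi | hi
  · subst hi
    obtain rfl : n = j + 1 := by omega
    rcases Nat.eq_zero_or_pos j with hj | hj
    · subst hj
      have g1 := hc 0 (by omega)
      have g2 := hq 0 (by omega)
      have e1 := h.q0
      have e2 := h.qn
      rw [zero_add] at e2 g1 g2
      rw [e1, e2] at g2
      linarith
    · exact end_defect hrep hG1 hS hS'' hT j hj h IH' hl'
  · rcases Nat.eq_zero_or_pos j with hj | hj
    · subst hj
      obtain rfl : n = i + 1 := by omega
      have hrep' := hrep.reflect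
      refine end_defect (c := fun m => c (i + 1 - m)) (q := fun m => q (i + 1 - m)) hrep' hG1 hS
        hS'' hT i hi ?_ (fun n' hn' => IH n' hn' hrep') ?_
      · refine ⟨hrep'.le, fun m n hmn a b => lemmaR hR hrep' m n hmn a b, ?_, ?_, ?_, ?_⟩
        · intro m hm
          have := hc (i + 1 - (m + 1)) (by omega)
          rw [show i + 1 - (m + 1) + 1 = i + 1 - m by omega] at this
          simpa using this
        · intro m hm
          have := hq (i + 1 - (m + 1)) (by omega)
          rw [show i + 1 - (m + 1) + 1 = i + 1 - m by omega] at this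
          simpa using this
        · simpa using h.qn
        · simpa using h.q0
      · simp only [Nat.sub_self, Nat.add_sub_cancel_left]
        obtain ⟨s, t, g1, g2, g3⟩ := hl'
        exact ⟨t, s, by simpa using g1, by simpa using g3, by simpa using g2⟩
    · obtain ⟨i', rfl⟩ : ∃ i', i = i' + 1 := ⟨i - 1, by omega⟩
      obtain ⟨j', rfl⟩ : ∃ j', j = j' + 1 := ⟨j - 1, by omega⟩
      obtain rfl : n = j' + i' + 3 := by omega
      exact hT j' i' (interior_T hrep j' i' h IH' hl')

/-! ### Lemma K -/

section
variable {V : Type*} {L R : V → ℝ}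

/-- The `i`-th step of a walk `p` with heights `h`. -/
def St (L R : V → ℝ) (p : ℕ → V) (h : ℕ → ℤ) (i : ℕ) : Prop :=
  (R (p i) < L (p (i + 1)) ∧ h (i + 1) = h i + 1) ∨
    (L (p i) ≤ R (p (i + 1)) ∧ h (i + 1) = h i - 1)

theorem St.dn {p : ℕ → V} {h : ℕ → ℤ} {i : ℕ} (hs : St L R p h i) (hi : h (i + 1) = h i - 1) :
    L (p i) ≤ R (p (i + 1)) := by
  rcases hs with hs | hs
  · omega
  · exact hs.1

theorem St.up {p : ℕ → V} {h : ℕ → ℤ} {i : ℕ} (hs : St L R p h i) (hi : h (i + 1) = h i + 1) :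
    R (p i) < L (p (i + 1)) := by
  rcases hs with hs | hs
  · exact hs.1
  · omega

theorem St.pm {p : ℕ → V} {h : ℕ → ℤ} {i : ℕ} (hs : St L R p h i) :
    h (i + 1) = h i + 1 ∨ h (i + 1) = h i - 1 := by
  rcases hs with hs | hs
  · exact Or.inl hs.2
  · exact Or.inr hs.2

theorem cross {N : ℕ} {h : ℕ → ℤ} (hst : ∀ i < N, h (i + 1) = h i + 1 ∨ h (i + 1) = h i - 1)
    (k : ℤ) (s e : ℕ) (hse : s ≤ e) (heN : e ≤ N) (h1 : k ≤ h s) (h2 : h e < k) :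
    ∃ m, s ≤ m ∧ m < e ∧ h m = k ∧ h (m + 1) = k - 1 := by
  induction e with
  | zero =>
    obtain rfl : s = 0 := by omega
    omega
  | succ e ih =>
    rcases Nat.eq_or_lt_of_le hse with rfl | h3
    · omega
    by_cases h4 : h e < k
    · obtain ⟨m, a1, a2, a3⟩ := ih (by omega) (by omega) h4
      exact ⟨m, a1, by omega, a3⟩
    · have := hst e (by omega)
      exact ⟨e, by omega, by omega, by omega, by omega⟩

theorem dn_run {p : ℕ → V} {h : ℕ → ℤ} (s e : ℕ) (hse : s ≤ e)
    (hst : ∀ i, s ≤ i → i < e → St L R p h i ∧ h (i + 1) = h i - 1) :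
    DnN L R (e - s) (p s) (p e) ∧ h e = h s - ((e - s : ℕ) : ℤ) := by
  induction e with
  | zero =>
    obtain rfl : s = 0 := by omega
    exact ⟨rfl, by simp⟩
  | succ e ih =>
    rcases Nat.eq_or_lt_of_le hse with rfl | h3
    · rw [Nat.sub_self]
      exact ⟨rfl, by simp⟩
    have := ih (by omega) (fun i h1 h2 => hst i h1 (by omega))
    have h4 := hst e (by omega) (by omega)
    rw [show e + 1 - s = (e - s) + 1 by omega]
    refine ⟨⟨p e, this.1, h4.1.dn h4.2⟩, ?_⟩
    rw [h4.2, this.2]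
    push_cast
    ring

theorem up_run {p : ℕ → V} {h : ℕ → ℤ} (s e : ℕ) (hse : s ≤ e)
    (hst : ∀ i, s ≤ i → i < e → St L R p h i ∧ h (i + 1) = h i + 1) :
    UpN L R (e - s) (p s) (p e) ∧ h e = h s + ((e - s : ℕ) : ℤ) := by
  induction e with
  | zero =>
    obtain rfl : s = 0 := by omega
    exact ⟨rfl, by simp⟩
  | succ e ih =>
    rcases Nat.eq_or_lt_of_le hse with rfl | h3
    · rw [Nat.sub_self]
      exact ⟨rfl, by simp⟩
    have := ih (by omega) (fun i h1 h2 => hst i h1 (by omega))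
    have h4 := hst e (by omega) (by omega)
    rw [show e + 1 - s = (e - s) + 1 by omega]
    refine ⟨⟨p e, this.1, h4.1.up h4.2⟩, ?_⟩
    rw [h4.2, this.2]
    push_cast
    ring

theorem lemmaK_fun (Z : ∀ n, ZProp L R n) (N : ℕ) :
    ∀ (p : ℕ → V) (h : ℕ → ℤ), (∀ i < N, St L R p h i) → h 0 = 0 → h N = 1 →
      Loose L R (p N) (p 0) → False := by
  induction N using Nat.strong_induction_on with
  | _ N IH =>
  intro p h hst h0 hN hl
  -- subwalks of value one are not closed by loose steps
  have sub : ∀ s e, s ≤ e → e ≤ N → e - s < N → h e = h s + 1 → Loose L R (p e) (p s) → False := by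
    intro s e h1 h2 h3 h4 h5
    refine IH (e - s) h3 (fun m => p (s + m)) (fun m => h (s + m) - h s) ?_ (by simp) ?_ ?_
    · intro i hi
      rcases hst (s + i) (by omega) with g | g
      · exact Or.inl ⟨g.1, by have := g.2; simp only [← add_assoc]; omega⟩
      · exact Or.inr ⟨g.1, by have := g.2; simp only [← add_assoc]; omega⟩
    · simp only [show s + (e - s) = e by omega]
      omega
    · simp only [show s + (e - s) = e by omega, add_zero]
      exact h5
  have hpm : ∀ i < N, h (i + 1) = h i + 1 ∨ h (i + 1) = h i - 1 := fun i hi => (hst i hi).pm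
  have A : ∀ i < N, h i = 1 → h (i + 1) = 0 → False := by
    intro i hi h1 h2
    have d := (hst i hi).dn (by omega)
    obtain ⟨s, t, st, l1, l2⟩ := hl
    by_cases h' : L (p i) ≤ R s
    · exact sub 0 i (by omega) (by omega) (by omega) (by omega) ⟨s, t, st, h', l2⟩
    · push Not at h'
      exact sub (i + 1) N (by omega) (by omega) (by omega) (by omega) ⟨s, p i, h', l1, d⟩
  have B : ∀ i j, i < j → j < N → h i = h j → h (i + 1) = h i - 1 → h (j + 1) = h j - 1 →
      False := by
    intro i j hij hj e1 e2 e3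
    have d1 := (hst i (by omega)).dn e2
    have d2 := (hst j (by omega)).dn e3
    by_cases h' : L (p i) ≤ R (p (j + 1))
    · refine IH (N - (j - i)) (by omega) (fun m => if m ≤ i then p m else p (m + (j - i)))
        (fun m => if m ≤ i then h m else h (m + (j - i))) ?_ ?_ ?_ ?_
      · intro m hm
        rcases Nat.lt_trichotomy m i with g | g | g
        · have := hst m (by omega)
          unfold St at this ⊢
          simpa only [show m ≤ i by omega, show m + 1 ≤ i by omega, if_true] using this
        · subst g
          right
          simp only [le_refl, if_true, show ¬ (m + 1 ≤ m) by omega, if_false,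
            show m + 1 + (j - m) = j + 1 by omega]
          exact ⟨h', by omega⟩
        · have := hst (m + (j - i)) (by omega)
          unfold St at this ⊢
          simp only [show ¬ (m ≤ i) by omega, show ¬ (m + 1 ≤ i) by omega, if_false,
            show m + 1 + (j - i) = m + (j - i) + 1 by omega]
          exact this
      · simp [h0]
      · simp only [show ¬ (N - (j - i) ≤ i) by omega, if_false,
          show N - (j - i) + (j - i) = N by omega]
        exact hN
      · simp only [show ¬ (N - (j - i) ≤ i) by omega, if_false,
          show N - (j - i) + (j - i) = N by omega, Nat.zero_le, if_true]
        exact hl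
    · push Not at h'
      exact sub (i + 1) j (by omega) (by omega) (by omega) (by omega) ⟨p (j + 1), p i, h', d2, d1⟩
  have C : ∀ i j k, i < j → j < k → k < N → h (i + 1) = h i + 1 → h (j + 1) = h j - 1 →
      h (k + 1) = h k + 1 → False := by
    intro i j k hij hjk hk e1 e2 e3
    rcases lt_trichotomy (h j) 1 with g | g | g
    · by_cases f : 0 ≤ h i
      · obtain ⟨m, m1, m2, m3, m4⟩ := cross hpm 1 (i + 1) j (by omega) (by omega) (by omega) g
        exact A m (by omega) m3 (by omega)
      · by_cases f2 : h j - 1 ≤ h i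
        · obtain ⟨m, m1, m2, m3, m4⟩ := cross hpm (h i + 1) 0 i (by omega) (by omega) (by omega)
            (by omega)
          obtain ⟨m', m1', m2', m3', m4'⟩ := cross hpm (h i + 1) (i + 1) (j + 1) (by omega)
            (by omega) (by omega) (by omega)
          exact B m m' (by omega) (by omega) (by omega) (by omega) (by omega)
        · obtain ⟨m, m1, m2, m3, m4⟩ := cross hpm (h j) 0 i (by omega) (by omega) (by omega)
            (by omega)
          exact B m j (by omega) (by omega) (by omega) (by omega) (by omega)
    · exact A j (by omega) g (by omega)
    · by_cases f : h k ≤ 0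
      · obtain ⟨m, m1, m2, m3, m4⟩ := cross hpm 1 (j + 1) k (by omega) (by omega) (by omega)
          (by omega)
        exact A m (by omega) m3 (by omega)
      · by_cases f2 : h k + 1 ≤ h j
        · obtain ⟨m, m1, m2, m3, m4⟩ := cross hpm (h k + 1) j k (by omega) (by omega) (by omega)
            (by omega)
          obtain ⟨m', m1', m2', m3', m4'⟩ := cross hpm (h k + 1) (k + 1) N (by omega)
            (by omega) (by omega) (by omega)
          exact B m m' (by omega) (by omega) (by omega) (by omega) (by omega)
        · obtain ⟨m, m1, m2, m3, m4⟩ := cross hpm (h j) (k + 1) N (by omega) (by omega) (by omega)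
            (by omega)
          exact B j m (by omega) (by omega) (by omega) (by omega) (by omega)
  -- there is an up step
  have ex : ∃ i, i < N ∧ h (i + 1) = h i + 1 := by
    by_contra hno
    push Not at hno
    have := (dn_run (L := L) (R := R) (p := p) (h := h) 0 N (by omega) (fun i _ hi =>
      ⟨hst i hi, (hpm i hi).resolve_left (hno i hi)⟩)).2
    omega
  obtain ⟨a, ⟨ha, ha1⟩, ha2⟩ : ∃ a, (a < N ∧ h (a + 1) = h a + 1) ∧
      ∀ i < a, ¬ (i < N ∧ h (i + 1) = h i + 1) := by
    classical
    exact ⟨Nat.find ex, Nat.find_spec ex, fun i hi => Nat.find_min ex hi⟩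
  obtain ⟨b, hab, hbN, hb1, hb2⟩ : ∃ b, a < b ∧ b ≤ N ∧ (∀ i, a ≤ i → i < b → h (i + 1) = h i + 1) ∧
      ∀ i, b ≤ i → i < N → h (i + 1) = h i - 1 := by
    by_cases ex2 : ∃ i, a < i ∧ i < N ∧ h (i + 1) = h i - 1
    · classical
      refine ⟨Nat.find ex2, (Nat.find_spec ex2).1, (Nat.find_spec ex2).2.1.le, ?_, ?_⟩
      · intro i h1 h2
        rcases Nat.eq_or_lt_of_le h1 with rfl | h3
        · exact ha1
        have := Nat.find_min ex2 h2
        have hlt := (Nat.find_spec ex2).2.1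
        rcases hpm i (by omega) with g | g
        · exact g
        · exact absurd ⟨h3, by omega, g⟩ this
      · intro i h1 h2
        have hsp := Nat.find_spec ex2
        rcases Nat.eq_or_lt_of_le h1 with h3 | h3
        · rw [← h3]
          exact hsp.2.2
        · rcases hpm i h2 with g | g
          · exact (C a _ i hsp.1 h3 h2 ha1 hsp.2.2 g).elim
          · exact g
    · push Not at ex2
      refine ⟨N, ha, le_rfl, ?_, by omega⟩
      intro i h1 h2
      rcases Nat.eq_or_lt_of_le h1 with rfl | h3
      · exact ha1
      · exact (hpm i h2).resolve_right (ex2 i h3 h2)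
  have r1 := dn_run (L := L) (R := R) (p := p) (h := h) 0 a (by omega) (fun i _ hi =>
      ⟨hst i (by omega), (hpm i (by omega)).resolve_left (fun g => ha2 i hi ⟨by omega, g⟩)⟩)
  have r2 := up_run (L := L) (R := R) (p := p) (h := h) a b (by omega) (fun i h1 hi =>
      ⟨hst i (by omega), hb1 i h1 hi⟩)
  have r3 := dn_run (L := L) (R := R) (p := p) (h := h) b N (by omega) (fun i h1 hi =>
      ⟨hst i (by omega), hb2 i h1 hi⟩)
  exact Z (b - a) _ _ _ _ (N - b) (a - 0) (by omega) r2.1 r3.1 hl r1.1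

/-- Walks with up steps and down steps, and their value. -/
inductive Wk (L R : V → ℝ) : ℤ → V → V → Prop
  | refl (a : V) : Wk L R 0 a a
  | up {k : ℤ} {a b c : V} : Wk L R k a b → R b < L c → Wk L R (k + 1) a c
  | dn {k : ℤ} {a b c : V} : Wk L R k a b → L b ≤ R c → Wk L R (k - 1) a c

theorem Wk.trans {k l : ℤ} {a b c : V} (h1 : Wk L R k a b) (h2 : Wk L R l b c) :
    Wk L R (k + l) a c := by
  induction h2 with
  | refl => simpa using h1
  | up _ h ih => simpa only [add_assoc] using (ih h1).up h
  | dn _ h ih => simpa only [add_sub_assoc] using (ih h1).dn h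

theorem Wk.cast {k l : ℤ} {a b : V} (h1 : Wk L R k a b) (h : k = l) : Wk L R l a b := h ▸ h1

theorem Wk.exists_fun {k : ℤ} {a b : V} (h1 : Wk L R k a b) :
    ∃ (N : ℕ) (p : ℕ → V) (h : ℕ → ℤ), (∀ i < N, St L R p h i) ∧ p 0 = a ∧ p N = b ∧ h 0 = 0 ∧
      h N = k := by
  induction h1 with
  | refl a => exact ⟨0, fun _ => a, fun _ => 0, by simp, rfl, rfl, rfl, rfl⟩
  | @up k a b c _ hs ih =>
    obtain ⟨N, p, h, h1, rfl, rfl, h4, rfl⟩ := ih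
    refine ⟨N + 1, fun m => if m ≤ N then p m else c, fun m => if m ≤ N then h m else h N + 1,
      ?_, by simp, by simp, by simp [h4], by simp⟩
    intro i hi
    unfold St
    rcases Nat.eq_or_lt_of_le (Nat.le_of_lt_succ hi) with rfl | h5
    · simp only [le_refl, if_true, show ¬ (i + 1 ≤ i) by omega, if_false]
      exact Or.inl ⟨hs, by simp⟩
    · simp only [show i ≤ N by omega, show i + 1 ≤ N by omega, if_true]
      exact h1 i h5
  | @dn k a b c _ hs ih =>
    obtain ⟨N, p, h, h1, rfl, rfl, h4, rfl⟩ := ih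
    refine ⟨N + 1, fun m => if m ≤ N then p m else c, fun m => if m ≤ N then h m else h N - 1,
      ?_, by simp, by simp, by simp [h4], by simp⟩
    intro i hi
    unfold St
    rcases Nat.eq_or_lt_of_le (Nat.le_of_lt_succ hi) with rfl | h5
    · simp only [le_refl, if_true, show ¬ (i + 1 ≤ i) by omega, if_false]
      exact Or.inr ⟨hs, by simp⟩
    · simp only [show i ≤ N by omega, show i + 1 ≤ N by omega, if_true]
      exact h1 i h5

theorem Wk.pad (hle : ∀ v, L v ≤ R v) {k : ℤ} {a b : V} (h : Wk L R k a b) (m : ℕ) :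
    Wk L R (k - m) a b := by
  induction m with
  | zero => simpa using h
  | succ m ih => exact (ih.dn (hle b)).cast (by push_cast; ring)

theorem lemmaK (hle : ∀ v, L v ≤ R v) (Z : ∀ n, ZProp L R n) {k : ℤ} {a b : V} (hk : 1 ≤ k)
    (h : Wk L R k a b) (hl : Loose L R b a) : False := by
  have h1 := (h.pad hle (k - 1).toNat).cast (l := 1) (by omega)
  obtain ⟨N, p, hh, g1, rfl, rfl, g4, g5⟩ := h1.exists_fun
  exact lemmaK_fun Z N p hh g1 g4 g5 hl

theorem Wk.exists_up {k : ℤ} {a b : V} (hk : 1 ≤ k) (h : Wk L R k a b) :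
    ∃ u v k1 k2, Wk L R k1 a u ∧ R u < L v ∧ Wk L R k2 v b ∧ k1 + 1 + k2 = k := by
  induction h with
  | refl => omega
  | @up k a b c h1 h2 ih => exact ⟨b, c, k, 0, h1, h2, Wk.refl c, by omega⟩
  | @dn k a b c h1 h2 ih =>
    obtain ⟨u, v, k1, k2, g1, g2, g3, g4⟩ := ih (by omega)
    exact ⟨u, v, k1, k2 - 1, g1, g2, g3.dn h2, by omega⟩

theorem no_loop (hle : ∀ v, L v ≤ R v) (Z : ∀ n, ZProp L R n) {k : ℤ} {a : V} (hk : 1 ≤ k)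
    (h : Wk L R k a a) : False := by
  obtain ⟨u, v, k1, k2, g1, g2, g3, g4⟩ := h.exists_up hk
  have W := (g3.trans g1).cast (l := k - 1) (by omega)
  have key : ∀ (j : ℤ) (v' w : V), Wk L R j v' w → v' = v → Wk L R (k - 1 - j) w u →
      R u < L w := by
    intro j v' w hw
    induction hw with
    | refl => rintro rfl _; exact g2
    | @up j v' w' w h1 h2 ih =>
      intro e h3
      have := ih e ((((Wk.refl w').up h2).trans h3).cast (by ring))
      linarith [hle w']
    | @dn j v' w' w h1 h2 ih =>
      intro e h3
      have := ih e ((((Wk.refl w').dn h2).trans h3).cast (by ring))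
      by_contra h'
      push Not at h'
      subst e
      have W2 := ((h3.up g2).trans (h1.dn h2)).cast (l := k) (by ring)
      exact lemmaK hle Z hk W2 ⟨u, w', this, h', h2⟩
  have := key (k - 1) v u W rfl ((Wk.refl u).cast (by ring))
  linarith [hle u]

end

/-! ### The potential -/

section
variable {V : Type*} {L R : V → ℝ}

open Classical in
/-- Weight of a step. -/
noncomputable def wt (L R : V → ℝ) (M : ℤ) (a b : V) : ℤ :=
  if R a < L b then M else if Loose L R a b then 1 - M else - M

/-- Weighted walks of a given length. -/
inductive GW (L R : V → ℝ) (M : ℤ) : ℕ → V → V → ℤ → Prop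
  | refl (a : V) : GW L R M 0 a a 0
  | snoc {n : ℕ} {a b c : V} {z : ℤ} : GW L R M n a b z → L b ≤ R c →
      GW L R M (n + 1) a c (z + wt L R M b c)

/-- Simple weighted walks; the list collects the visited vertices. -/
inductive SP (L R : V → ℝ) (M : ℤ) : List V → V → ℤ → Prop
  | single (a : V) : SP L R M [a] a 0
  | snoc {l : List V} {a b : V} {z : ℤ} : SP L R M l a z → L a ≤ R b → b ∉ l →
      SP L R M (b :: l) b (z + wt L R M a b)

theorem GW.decomp {M : ℤ} {n : ℕ} {a b : V} {z : ℤ} (h : GW L R M n a b z) :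
    ∃ k r : ℤ, z = M * k + r ∧ 0 ≤ r ∧ r ≤ n ∧ Wk L R k a b ∧
      (0 < r → ∃ c d k1 k2, Wk L R k1 a c ∧ Loose L R c d ∧ Wk L R k2 d b ∧ k = k1 - 1 + k2) := by
  induction h with
  | refl a => exact ⟨0, 0, by simp, le_rfl, by simp, Wk.refl a, by simp⟩
  | @snoc n a b c z _ h2 ih =>
    obtain ⟨k, r, g1, g2, g3, g4, g5⟩ := ih
    unfold wt
    split_ifs with c1 c2
    · refine ⟨k + 1, r, by rw [g1]; ring, g2, by push_cast; omega, g4.up c1, ?_⟩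
      intro hr
      obtain ⟨x, y, k1, k2, f1, f2, f3, f4⟩ := g5 hr
      exact ⟨x, y, k1, k2 + 1, f1, f2, f3.up c1, by omega⟩
    · refine ⟨k - 1, r + 1, by rw [g1]; ring, by omega, by push_cast; omega, g4.dn h2, ?_⟩
      intro hr
      exact ⟨b, c, k, 0, g4, c2, Wk.refl c, by omega⟩
    · refine ⟨k - 1, r, by rw [g1]; ring, g2, by push_cast; omega, g4.dn h2, ?_⟩
      intro hr
      obtain ⟨x, y, k1, k2, f1, f2, f3, f4⟩ := g5 hr
      exact ⟨x, y, k1, k2 - 1, f1, f2, f3.dn h2, by omega⟩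

theorem GW.closed (hle : ∀ v, L v ≤ R v) (Z : ∀ n, ZProp L R n) {M : ℤ} {n : ℕ} {a : V} {z : ℤ}
    (h : GW L R M n a a z) (hn : (n : ℤ) ≤ M) : z ≤ 0 := by
  obtain ⟨k, r, g1, g2, g3, g4, g5⟩ := h.decomp
  rcases lt_trichotomy k 0 with hk | hk | hk
  · nlinarith
  · subst hk
    rcases Int.lt_or_le 0 r with hr | hr
    · obtain ⟨x, y, k1, k2, f1, f2, f3, f4⟩ := g5 hr
      exact (lemmaK hle Z (k := k2 + k1) (by omega) (f3.trans f1) f2).elim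
    · omega
  · exact (no_loop hle Z (by omega) g4).elim

theorem SP.nodup {M : ℤ} {l : List V} {a : V} {z : ℤ} (h : SP L R M l a z) : l.Nodup := by
  induction h with
  | single a => simp
  | snoc _ _ hb ih => exact List.nodup_cons.2 ⟨hb, ih⟩

theorem SP.le {M : ℤ} (hM : 1 ≤ M) {l : List V} {a : V} {z : ℤ} (h : SP L R M l a z) :
    z ≤ M * l.length := by
  induction h with
  | single a => simp; omega
  | @snoc l a b z _ _ _ ih =>
    have : wt L R M a b ≤ M := by
      unfold wt
      split_ifs <;> omega
    simp only [List.length_cons]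
    push_cast
    nlinarith

theorem SP.cut {M : ℤ} {l : List V} {a : V} {z : ℤ} (h : SP L R M l a z) (c : V) (hc : c ∈ l) :
    ∃ l' z1 z2 n, SP L R M l' c z1 ∧ GW L R M n c a z2 ∧ z = z1 + z2 ∧ n + 1 ≤ l.length := by
  induction h with
  | single a =>
    obtain rfl : c = a := by simpa using hc
    exact ⟨[c], 0, 0, 0, SP.single c, GW.refl c, by simp, by simp⟩
  | @snoc l a b z h1 h2 h3 ih =>
    by_cases e : c = b
    · subst e
      exact ⟨_, _, 0, 0, h1.snoc h2 h3, GW.refl c, by simp, by simp⟩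
    · obtain ⟨l', z1, z2, n, g1, g2, g3, g4⟩ := ih (by simpa [e] using hc)
      exact ⟨l', z1, _, n + 1, g1, g2.snoc h2, by rw [g3]; ring, by simpa using g4⟩

theorem exists_potential [Fintype V] (hle : ∀ v, L v ≤ R v) (Z : ∀ n, ZProp L R n) :
    ∃ (M : ℤ) (y : V → ℤ), 1 ≤ M ∧ ∀ a b, L a ≤ R b → y a + wt L R M a b ≤ y b := by
  set M : ℤ := (Fintype.card V : ℤ) + 1 with hM
  have M1 : 1 ≤ M := by omega
  have len : ∀ {l : List V} {a : V} {z : ℤ}, SP L R M l a z → l.length ≤ Fintype.card V :=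
    fun h => h.nodup.length_le_card
  have ex : ∀ v : V, ∃ z : ℤ, (∃ l, SP L R M l v z) ∧ ∀ z', (∃ l, SP L R M l v z') → z' ≤ z := by
    intro v
    apply Int.exists_greatest_of_bdd
    · refine ⟨M * Fintype.card V, ?_⟩
      rintro z ⟨l, hl⟩
      have h1 := hl.le M1
      have h2 : (l.length : ℤ) ≤ Fintype.card V := by exact_mod_cast len hl
      nlinarith
    · exact ⟨0, [v], SP.single v⟩
  choose y hy1 hy2 using ex
  refine ⟨M, y, M1, ?_⟩
  intro a b hab
  obtain ⟨l, hl⟩ := hy1 a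
  by_cases hb : b ∈ l
  · obtain ⟨l', z1, z2, n, g1, g2, g3, g4⟩ := hl.cut b hb
    have h1 := hy2 b z1 ⟨l', g1⟩
    have h2 := len hl
    have h3 := (g2.snoc hab).closed hle Z (by push_cast; omega)
    omega
  · exact hy2 b _ ⟨_, hl.snoc hab hb⟩

end

/-- Final construction of the mixed unit interval representation. -/
theorem mixed_of_potential {V : Type*} {G : SimpleGraph V} {L R : V → ℝ} (hrep : CRep G L R)
    {M : ℤ} {y : V → ℤ} (hM : 1 ≤ M) (hy : ∀ a b, L a ≤ R b → y a + wt L R M a b ≤ y b) :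
    MixedUnitIntervalGraph G := by
  have hle := hrep.le
  -- constraints on integer level
  have K1 : ∀ u v, R u < L v → y u + M ≤ y v := by
    intro u v h
    have := hy u v (by linarith [hle u, hle v])
    unfold wt at this
    rwa [if_pos h] at this
  have K2 : ∀ u v, L u ≤ R v → y u - M ≤ y v := by
    intro u v h
    have := hy u v h
    unfold wt at this
    split_ifs at this <;> omega
  have K3 : ∀ u v, Loose L R u v → y u - M < y v := by
    intro u v h
    have := hy u v h.dn
    unfold wt at this
    split_ifs at this <;> omega
  have Mpos : (0 : ℝ) < M := by exact_mod_cast (by omega : 0 < M)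
  obtain ⟨x, hx⟩ : ∃ x : V → ℝ, ∀ v, x v * M = y v := ⟨fun v => y v / M, fun v => by
    field_simp⟩
  have X1 : ∀ u v, R u < L v → x u + 1 ≤ x v := by
    intro u v h
    have : ((y u + M : ℤ) : ℝ) ≤ y v := by exact_mod_cast K1 u v h
    push_cast at this
    rw [← hx, ← hx] at this
    nlinarith
  have X2 : ∀ u v, L u ≤ R v → x u ≤ x v + 1 := by
    intro u v h
    have : ((y u - M : ℤ) : ℝ) ≤ y v := by exact_mod_cast K2 u v h
    push_cast at this
    rw [← hx, ← hx] at this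
    nlinarith
  have X3 : ∀ u v, Loose L R u v → x u < x v + 1 := by
    intro u v h
    have : ((y u - M : ℤ) : ℝ) < y v := by exact_mod_cast K3 u v h
    push_cast at this
    rw [← hx, ← hx] at this
    nlinarith
  clear K1 K2 K3 hx
  let lc : V → Prop := fun v => ∃ u, Ov L R u v ∧ x v = x u + 1
  let rc : V → Prop := fun u => ∃ v, Ov L R u v ∧ x v = x u + 1
  let f : V → Set ℝ := fun v =>
    {z | (x v < z ∧ z < x v + 1) ∨ (z = x v ∧ lc v) ∨ (z = x v + 1 ∧ rc v)}
  have D : ∀ u v, R u < L v → ¬ (f u ∩ f v).Nonempty := by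
    rintro u v h ⟨z, hu, hv⟩
    have h1 := X1 u v h
    have e : z = x u + 1 ∧ rc u := by
      rcases hu with hu | hu | hu
      · rcases hv with hv | hv | hv
        · linarith
        · linarith
        · linarith
      · rcases hv with hv | hv | hv
        · linarith
        · linarith
        · linarith
      · exact hu
    have e' : z = x v ∧ lc v := by
      rcases hv with hv | hv | hv
      · linarith
      · exact hv
      · linarith
    obtain ⟨e1, v', o1, w1⟩ := e
    obtain ⟨e2, u', o2, w2⟩ := e'
    have := X3 v' u' ⟨u, v, h, o1.2, o2.2⟩
    linarith
  have A : ∀ u v, Ov L R u v → x u ≤ x v → (f u ∩ f v).Nonempty := by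
    intro u v o h
    have h2 := X2 v u o.2
    rcases lt_or_eq_of_le h2 with h3 | h3
    · exact ⟨(x v + x u + 1) / 2, Or.inl ⟨by linarith, by linarith⟩,
        Or.inl ⟨by linarith, by linarith⟩⟩
    · exact ⟨x v, Or.inr (Or.inr ⟨h3, v, o, h3⟩), Or.inr (Or.inl ⟨rfl, u, o, h3⟩)⟩
  refine ⟨f, ?_, ?_⟩
  · intro u v huv
    rw [hrep.adj u v huv]
    constructor
    · intro o
      rcases le_total (x u) (x v) with h | h
      · exact A u v o h
      · rw [Set.inter_comm]
        exact A v u ⟨o.2, o.1⟩ h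
    · intro h
      constructor
      · by_contra h'
        push Not at h'
        rw [Set.inter_comm] at h
        exact D v u h' h
      · by_contra h'
        push Not at h'
        exact D u v h' h
  · intro v
    refine ⟨x v, ?_⟩
    by_cases h1 : lc v <;> by_cases h2 : rc v
    · left
      ext z
      simp only [f, h1, h2, Set.mem_ofPred_eq, Set.mem_Icc, and_true]
      constructor
      · rintro (h | h | h) <;> constructor <;> linarith
      · rintro ⟨g1, g2⟩
        rcases lt_or_eq_of_le g1 with g1 | g1
        · rcases lt_or_eq_of_le g2 with g2 | g2
          · exact Or.inl ⟨g1, g2⟩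
          · exact Or.inr (Or.inr g2)
        · exact Or.inr (Or.inl g1.symm)
    · right; right; right
      ext z
      simp only [f, h1, h2, Set.mem_ofPred_eq, Set.mem_Ico, and_true, and_false, or_false]
      constructor
      · rintro (h | h) <;> constructor <;> linarith
      · rintro ⟨g1, g2⟩
        rcases lt_or_eq_of_le g1 with g1 | g1
        · exact Or.inl ⟨g1, g2⟩
        · exact Or.inr g1.symm
    · right; right; left
      ext z
      simp only [f, h1, h2, Set.mem_ofPred_eq, Set.mem_Ioc, and_true, and_false, false_or]
      constructor
      · rintro (h | h) <;> constructor <;> linarith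
      · rintro ⟨g1, g2⟩
        rcases lt_or_eq_of_le g2 with g2 | g2
        · exact Or.inl ⟨g1, g2⟩
        · exact Or.inr g2
    · right; left
      ext z
      simp only [f, h1, h2, Set.mem_ofPred_eq, Set.mem_Ioo, and_false, or_false]

/-- Interval graphs have representations by nonempty closed intervals. -/
theorem IsIntervalGraph.crep {V : Type*} [Fintype V] {G : SimpleGraph V} (h : IsIntervalGraph G) :
    ∃ L R, CRep G L R := by
  classical
  obtain ⟨f, hf, hI⟩ := h
  choose a b hab using hI
  obtain ⟨B, hB⟩ := (Set.finite_range b).bddAbove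
  have hB' : ∀ v, b v ≤ B := fun v => hB ⟨v, rfl⟩
  let e := Fintype.equivFin V
  let pt : V → ℝ := fun v => B + 1 + ((e v : ℕ) : ℝ)
  have hpt : ∀ v, B < pt v := by
    intro v
    have : (0 : ℝ) ≤ ((e v : ℕ) : ℝ) := Nat.cast_nonneg _
    simp only [pt]
    linarith
  have hne : ∀ u v, u ≠ v → pt u ≠ pt v := by
    intro u v huv h
    simp only [pt, add_right_inj, Nat.cast_inj] at h
    exact huv (e.injective (Fin.ext h))
  have key : ∀ u v, u ≠ v → (G.Adj u v ↔ a u ≤ b u ∧ a v ≤ b v ∧ a u ≤ b v ∧ a v ≤ b u) := by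
    intro u v huv
    rw [hf u v huv, hab u, hab v, Set.Icc_inter_Icc, Set.nonempty_Icc]
    simp only [sup_le_iff, le_inf_iff]
    tauto
  refine ⟨fun v => if a v ≤ b v then a v else pt v, fun v => if a v ≤ b v then b v else pt v, ?_, ?_⟩
  · intro v
    split_ifs with h <;> linarith
  · intro u v huv
    rw [key u v huv]
    have h1 := hpt u
    have h2 := hpt v
    have h3 := hB' u
    have h4 := hB' v
    have h5 := hne u v huv
    by_cases hu : a u ≤ b u <;> by_cases hv : a v ≤ b v
    · simp only [hu, hv, if_true, true_and]
    · simp only [hu, hv, if_true, if_false, false_and, and_false, false_iff]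
      rintro ⟨g1, g2⟩
      linarith
    · simp only [hu, hv, if_true, if_false, false_and, false_iff]
      rintro ⟨g1, g2⟩
      linarith
    · simp only [hu, hv, if_false, false_and, false_iff]
      rintro ⟨g1, g2⟩
      exact h5 (le_antisymm g1 g2)

/-- Corollary 6: a graph is a mixed unit interval graph if and only if it is an interval
graph with no induced G_1, R_i (i ≥ 0), S_i (i ≥ 1), S''_i (i ≥ 2) or T_{i,j} (i ≥ j ≥ 0). -/
theorem mixed_unit_characterization {V : Type*} [Fintype V] (G : SimpleGraph V) :
    MixedUnitIntervalGraph G ↔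
      (IsIntervalGraph G ∧
       ¬ HasInducedSubgraph G G1 ∧
       (∀ i : ℕ, ¬ HasInducedSubgraph G (Rgraph i)) ∧
       (∀ i : ℕ, 1 ≤ i → ¬ HasInducedSubgraph G (Sgraph i)) ∧
       (∀ i : ℕ, 2 ≤ i → ¬ HasInducedSubgraph G (S''graph i)) ∧
       (∀ i j : ℕ, j ≤ i → ¬ HasInducedSubgraph G (Tgraph i j))) := by
  constructor
  · intro h
    exact mixed_forward G h
  · rintro ⟨hI, hG1, hR, hS, hS2, hT⟩
    obtain ⟨L, R, hrep⟩ := hI.crep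
    have hT2 : ∀ i j : ℕ, ¬ HasInducedSubgraph G (Tgraph i j) := by
      intro i j h
      rcases le_total j i with hji | hji
      · exact hT i j hji h
      · exact hT j i hji (Tgraph_swap h)
    obtain ⟨M, y, hM, hy⟩ := exists_potential hrep.le
      (fun n => lemmaZ hG1 hR hS hS2 hT2 n hrep)
    exact mixed_of_potential hrep hM hy
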